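/- arXiv:2502.03331 — 5 statements merged into one kernel-verified Lean document; each statement's English description precedes it below -/
import Mathlib

section
/- Let λ ∈ ℝ and k ∈ L¹(ℝ³). For every continuous compactly supported f : ℝ → ℂ and every t ∈ ℝ, the triple integral ∫∫∫ k(a,b,c) e^{2πiλ(c+bt)} f(t+a) da db dc is absolutely convergent and equals ∫_ℝ K_λ(t,x) f(x) dx, where K_λ(t,x) = (𝓕₂₃ k)(x−t, −λt, −λ). In other words, the operator π_λ(k) = ∫_ℍ k(g) π_λ(g) dg is an integral operator whose kernel is the partial Fourier transform of k in the last two variables evaluated at (x−t, −λt, −λ). -/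
open MeasureTheory Complex

/-- The partial Fourier transform of `k : ℝ³ → ℂ` in the last two variables:
`(𝓕₂₃ k)(a, β, γ) = ∫∫ k(a,b,c) e^{−2πi(bβ+cγ)} db dc`. -/
noncomputable def F23 (k : ℝ × ℝ × ℝ → ℂ) (a β γ : ℝ) : ℂ :=
  ∫ b : ℝ, ∫ c : ℝ,
    k (a, b, c) * Complex.exp (-(2 * Real.pi * Complex.I * ((b : ℂ) * β + (c : ℂ) * γ)))

theorem heisenberg_pi_lambda_integral_kernel
    (lam : ℝ) (k : ℝ × ℝ × ℝ → ℂ) (hk : Integrable k (volume : Measure (ℝ × ℝ × ℝ)))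
    (f : ℝ → ℂ) (hf_cont : Continuous f) (hf_supp : HasCompactSupport f) (t : ℝ) :
    Integrable
      (fun g : ℝ × ℝ × ℝ =>
        k g * Complex.exp (2 * Real.pi * Complex.I * (lam : ℂ) * ((g.2.2 : ℂ) + (g.2.1 : ℂ) * t))
          * f (t + g.1))
      (volume : Measure (ℝ × ℝ × ℝ)) ∧
    (∫ g : ℝ × ℝ × ℝ,
        k g * Complex.exp (2 * Real.pi * Complex.I * (lam : ℂ) * ((g.2.2 : ℂ) + (g.2.1 : ℂ) * t))
          * f (t + g.1)) =
      ∫ x : ℝ, F23 k (x - t) (-(lam * t)) (-lam) * f x := by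
  set e : ℝ × ℝ × ℝ → ℂ := fun g =>
    Complex.exp (2 * Real.pi * Complex.I * (lam : ℂ) * ((g.2.2 : ℂ) + (g.2.1 : ℂ) * t)) with he
  have hke : Integrable (fun g => k g * e g) (volume : Measure (ℝ × ℝ × ℝ)) := by
    refine hk.mul_bdd (c := 1) (by fun_prop) (Filter.Eventually.of_forall fun g => ?_)
    have hg : 2 * Real.pi * Complex.I * (lam : ℂ) * ((g.2.2 : ℂ) + (g.2.1 : ℂ) * t) =
        ((2 * Real.pi * lam * (g.2.2 + g.2.1 * t) : ℝ) : ℂ) * Complex.I := by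
      push_cast; ring
    simp only [he]
    rw [hg, Complex.norm_exp_ofReal_mul_I]
  obtain ⟨C, hC⟩ := hf_supp.exists_bound_of_continuous hf_cont
  have hkef : Integrable (fun g : ℝ × ℝ × ℝ => k g * e g * f (t + g.1))
      (volume : Measure (ℝ × ℝ × ℝ)) :=
    hke.mul_bdd (c := C) (by fun_prop) (Filter.Eventually.of_forall fun g => hC _)
  refine ⟨hkef, ?_⟩
  have hshift : ∫ x : ℝ, F23 k (x - t) (-(lam * t)) (-lam) * f x =
      ∫ a : ℝ, F23 k a (-(lam * t)) (-lam) * f (t + a) := by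
    simpa using integral_sub_right_eq_self (μ := volume)
      (fun a : ℝ => F23 k a (-(lam * t)) (-lam) * f (t + a)) t
  rw [hshift]
  refine (integral_prod _ hkef).trans (integral_congr_ae ?_)
  filter_upwards [hke.prod_right_ae] with a ha
  refine (integral_mul_const _ _).trans ?_
  congr 1
  refine (integral_prod _ ha).trans ?_
  unfold F23
  refine integral_congr_ae (Filter.Eventually.of_forall fun b => ?_)
  refine integral_congr_ae (Filter.Eventually.of_forall fun c => ?_)
  simp only [he]
  congr 2
  push_cast
  ring
end

section
/- Let f be a continuous compactly supported function on the 'ax+b' group G = (0,∞) × ℝ. For every continuous compactly supported φ on (0,∞) and every s > 0, the absolutely convergent integral ∫∫ f(a,b) √a · e^{2πibs} · √(as) · φ(as) · a^{−2} da db equals ∫₀^∞ (√s / t) · (𝓕₂ f)(t/s, −s) · φ(t) dt. That is, the operator f̂(π⁺) = π⁺(f) D⁺, where π⁺(f) = ∫_G f(g) π⁺(g) dμ_L(g) and (D⁺φ)(t) = √t · φ(t), is an integral operator on L²((0,∞)) with kernel k_f⁺(s,t) = (√s / t) · (𝓕₂ f)(s^{−1}t, −s). -/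
open MeasureTheory Set Complex

/-- The partial Fourier transform in the second variable:
`(𝓕₂ f)(x, ξ) = ∫ f(x,b) e^{−2πibξ} db`. -/
noncomputable def F2 (f : ℝ × ℝ → ℂ) (x ξ : ℝ) : ℂ :=
  ∫ b : ℝ, f (x, b) * Complex.exp (-(2 * Real.pi * Complex.I * (b : ℂ) * (ξ : ℂ)))

/-- The integrand of `π⁺(f) D⁺ φ` at `s` is integrable, being continuous with compact support. -/
theorem integrable_axb_kernel
    (f : ℝ × ℝ → ℂ) (hf_cont : Continuous f) (hf_supp : HasCompactSupport f)
    (hf_in : tsupport f ⊆ Set.Ioi (0 : ℝ) ×ˢ Set.univ)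
    (φ : ℝ → ℂ) (hφ_cont : Continuous φ) (s : ℝ) :
    Integrable
      (fun p : ℝ × ℝ =>
        f p * (Real.sqrt p.1 : ℂ) *
          Complex.exp (2 * Real.pi * Complex.I * (p.2 : ℂ) * (s : ℂ)) *
          (Real.sqrt (p.1 * s) : ℂ) * φ (p.1 * s) * ((1 / p.1 ^ 2 : ℝ) : ℂ))
      (volume : Measure (ℝ × ℝ)) := by
  have h_supp : HasCompactSupport (fun p : ℝ × ℝ =>
        f p * (Real.sqrt p.1 : ℂ) *
          Complex.exp (2 * Real.pi * Complex.I * (p.2 : ℂ) * (s : ℂ)) *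
          (Real.sqrt (p.1 * s) : ℂ) * φ (p.1 * s) * ((1 / p.1 ^ 2 : ℝ) : ℂ)) :=
    hf_supp.mul_right.mul_right.mul_right.mul_right.mul_right
  refine Continuous.integrable_of_hasCompactSupport ?_ h_supp
  refine continuous_of_tsupport fun p hp => ?_
  have hp_f : p ∈ tsupport f := by
    refine closure_mono (fun q hq => ?_) hp
    contrapose! hq
    simp [Function.notMem_support.mp hq]
  have hp_ne : p.1 ^ 2 ≠ 0 := pow_ne_zero 2 (ne_of_gt (hf_in hp_f).1)
  have h_inv : ContinuousAt (fun q : ℝ × ℝ => 1 / q.1 ^ 2) p :=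
    continuousAt_const.div (by fun_prop) hp_ne
  refine ContinuousAt.mul (Continuous.continuousAt ?_)
    (Complex.continuous_ofReal.continuousAt.comp h_inv)
  fun_prop

/-- On the `ax+b` group `G = (0,∞) × ℝ` with left Haar measure `a⁻² da db`, the operator
`f̂(π⁺) = π⁺(f) D⁺` (with `(D⁺φ)(t) = √t φ(t)`) is the integral operator on `L²((0,∞))`
with kernel `k_f⁺(s,t) = (√s / t) (𝓕₂ f)(s⁻¹t, −s)`. -/
theorem axb_fourier_transform_integral_kernel
    (f : ℝ × ℝ → ℂ) (hf_cont : Continuous f) (hf_supp : HasCompactSupport f)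
    (hf_in : tsupport f ⊆ Set.Ioi (0 : ℝ) ×ˢ Set.univ)
    (φ : ℝ → ℂ) (hφ_cont : Continuous φ) (hφ_supp : HasCompactSupport φ)
    (hφ_in : tsupport φ ⊆ Set.Ioi (0 : ℝ)) (s : ℝ) (hs : 0 < s) :
    IntegrableOn
      (fun p : ℝ × ℝ =>
        f p * (Real.sqrt p.1 : ℂ) *
          Complex.exp (2 * Real.pi * Complex.I * (p.2 : ℂ) * (s : ℂ)) *
          (Real.sqrt (p.1 * s) : ℂ) * φ (p.1 * s) * ((1 / p.1 ^ 2 : ℝ) : ℂ))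
      (Set.Ioi (0 : ℝ) ×ˢ Set.univ) (volume : Measure (ℝ × ℝ)) ∧
    (∫ p in Set.Ioi (0 : ℝ) ×ˢ (Set.univ : Set ℝ),
        f p * (Real.sqrt p.1 : ℂ) *
          Complex.exp (2 * Real.pi * Complex.I * (p.2 : ℂ) * (s : ℂ)) *
          (Real.sqrt (p.1 * s) : ℂ) * φ (p.1 * s) * ((1 / p.1 ^ 2 : ℝ) : ℂ)) =
      ∫ t in Set.Ioi (0 : ℝ), ((Real.sqrt s / t : ℝ) : ℂ) * F2 f (t / s) (-s) * φ t := by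
  have h_int := integrable_axb_kernel f hf_cont hf_supp hf_in φ hφ_cont s
  refine ⟨h_int.integrableOn, ?_⟩
  rw [Measure.volume_eq_prod, setIntegral_prod _ h_int.integrableOn]
  have h_fiber : ∀ a ∈ Ioi (0 : ℝ), (∫ b in (univ : Set ℝ),
      f (a, b) * (Real.sqrt a : ℂ) *
        Complex.exp (2 * Real.pi * Complex.I * (b : ℂ) * (s : ℂ)) *
        (Real.sqrt (a * s) : ℂ) * φ (a * s) * ((1 / a ^ 2 : ℝ) : ℂ)) =
      (fun t : ℝ => (s : ℂ) * (((Real.sqrt s / t : ℝ) : ℂ) * F2 f (t / s) (-s) * φ t))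
        (a * s) := by
    intro a ha
    have ha' : (0 : ℝ) < a := ha
    have h_weight : Real.sqrt a * Real.sqrt (a * s) * (1 / a ^ 2) =
        s * (Real.sqrt s / (a * s)) := by
      rw [Real.sqrt_mul ha'.le, ← mul_assoc, Real.mul_self_sqrt ha'.le]
      field_simp
    have h_weight' : (Real.sqrt a : ℂ) * (Real.sqrt (a * s) : ℂ) * ((1 / a ^ 2 : ℝ) : ℂ) =
        (s : ℂ) * ((Real.sqrt s / (a * s) : ℝ) : ℂ) := by
      exact_mod_cast h_weight
    simp only [Measure.restrict_univ, F2, mul_div_cancel_right₀ a hs.ne']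
    calc
      _ = ∫ b : ℝ, ((s : ℂ) * ((Real.sqrt s / (a * s) : ℝ) : ℂ) * φ (a * s)) *
          (f (a, b) * Complex.exp (-(2 * Real.pi * Complex.I * (b : ℂ) * ((-s : ℝ) : ℂ)))) := by
        congr 1 with b
        rw [← h_weight', Complex.ofReal_neg, mul_neg, neg_neg]
        ring
      _ = _ := by
        rw [integral_const_mul]
        ring
  rw [setIntegral_congr_fun measurableSet_Ioi h_fiber,
    integral_comp_mul_right_Ioi
      (fun t : ℝ => (s : ℂ) * (((Real.sqrt s / t : ℝ) : ℂ) * F2 f (t / s) (-s) * φ t)) 0 hs,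
    zero_mul, integral_const_mul, Complex.real_smul, Complex.ofReal_inv, ← mul_assoc,
    inv_mul_cancel₀ (Complex.ofReal_ne_zero.mpr hs.ne'), one_mul]
end

section
/- For every continuous compactly supported function f on the 'ax+b' group G = (0,∞) × ℝ, the Plancherel identity holds in kernel form: ∫₀^∞ ∫₀^∞ (s/t²) |(𝓕₂ f)(t/s, −s)|² dt ds + ∫₀^∞ ∫₀^∞ (s/t²) |(𝓕₂ f)(t/s, s)|² dt ds = ∫₀^∞ ∫_ℝ |f(a,b)|² a^{−2} db da. That is, the sum of the squared Hilbert–Schmidt norms of the kernels of f̂(π⁺) and f̂(π⁻) equals the squared norm of f in L²(G, μ_L). -/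
open MeasureTheory Set Complex

open scoped FourierTransform ContDiff in
/-- On `L¹ ∩ L²` the integral Fourier transform agrees a.e. with the `L²` Fourier transform. -/
theorem fourier_toLp_ae_eq {g : ℝ → ℂ} (h1 : Integrable g) (h2 : MemLp g 2) :
    (𝓕 (h2.toLp g) : Lp ℂ 2 (volume : Measure ℝ)) =ᵐ[volume] 𝓕 g := by
  have hcont : Continuous (𝓕 g) :=
    VectorFourier.fourierIntegral_continuous Real.continuous_fourierChar
      (L := innerₗ ℝ) continuous_inner h1
  refine ae_eq_of_integral_contDiff_smul_eq ?_ hcont.locallyIntegrable ?_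
  · exact (Lp.memLp (𝓕 (h2.toLp g) : Lp ℂ 2 (volume : Measure ℝ))).locallyIntegrable (by norm_num)
  intro φ hφ hφs
  have hs : HasCompactSupport (fun x => (φ x : ℂ)) :=
    hφs.comp_left (g := fun x : ℝ => (x : ℂ)) (by simp)
  set ψ : SchwartzMap ℝ ℂ := hs.toSchwartzMap (Complex.ofRealCLM.contDiff.comp hφ)
  have hψφ : ∀ x, ψ x = φ x := fun x => rfl
  have key := congrArg (fun T => T ψ) (Lp.fourier_toTemperedDistribution_eq (h2.toLp g))
  simp only [TemperedDistribution.fourier_apply, Lp.toTemperedDistribution_apply] at key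
  have e1 : ∫ x, (𝓕 ψ) x • (h2.toLp g) x = ∫ x, (𝓕 ψ) x • g x := by
    apply integral_congr_ae
    filter_upwards [h2.coeFn_toLp] with x hx
    rw [hx]
  have e2 : ∫ x, (𝓕 ψ) x • g x = ∫ x, ψ x • 𝓕 g x := by
    simpa [SchwartzMap.fourier_coe] using!
      (VectorFourier.integral_fourierIntegral_smul_eq_flip (L := innerₗ ℝ)
        Real.continuous_fourierChar continuous_inner ψ.integrable h1)
  rw [e1, e2] at key
  simpa [hψφ] using key.symm

open scoped FourierTransform in
/-- Plancherel's theorem for the integral Fourier transform on `L¹ ∩ L²`. -/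
theorem integrable_norm_sq_fourier_and_integral_eq {g : ℝ → ℂ} (h1 : Integrable g)
    (h2 : MemLp g 2) :
    Integrable (fun ξ => ‖𝓕 g ξ‖ ^ 2) ∧ ∫ ξ, ‖𝓕 g ξ‖ ^ 2 = ∫ x, ‖g x‖ ^ 2 := by
  have hae := fourier_toLp_ae_eq h1 h2
  have hm : MemLp (𝓕 g) 2 := (memLp_congr_ae hae).1 (Lp.memLp _)
  have hsq : ∀ u : Lp ℂ 2 (volume : Measure ℝ), ‖u‖ ^ 2 = ∫ x, ‖u x‖ ^ 2 := by
    intro u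
    have h := L2.inner_def (𝕜 := ℂ) u u
    rw [inner_self_eq_norm_sq_to_K] at h
    simp only [inner_self_eq_norm_sq_to_K] at h
    have h' : ((‖u‖ ^ 2 : ℝ) : ℂ) = ((∫ x, ‖u x‖ ^ 2 : ℝ) : ℂ) := by
      rw [← integral_complex_ofReal]
      simpa using h
    exact_mod_cast h'
  refine ⟨(memLp_two_iff_integrable_sq_norm hm.1).1 hm, ?_⟩
  calc ∫ ξ, ‖𝓕 g ξ‖ ^ 2 = ∫ ξ, ‖(𝓕 (h2.toLp g) : Lp ℂ 2 (volume : Measure ℝ)) ξ‖ ^ 2 := by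
        apply integral_congr_ae
        filter_upwards [hae] with x hx
        rw [hx]
    _ = ∫ x, ‖(h2.toLp g) x‖ ^ 2 := by rw [← hsq, ← hsq, Lp.norm_fourier_eq]
    _ = ∫ x, ‖g x‖ ^ 2 := by
        apply integral_congr_ae
        filter_upwards [h2.coeFn_toLp] with x hx
        rw [hx]

open scoped FourierTransform in
theorem F2_eq_fourier (f : ℝ × ℝ → ℂ) (x : ℝ) : F2 f x = 𝓕 (fun b => f (x, b)) := by
  ext ξ
  rw [Real.fourier_real_eq_integral_exp_smul, F2]
  congr 1 with b
  rw [smul_eq_mul, mul_comm]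
  congr 2
  push_cast
  ring

/-- Plancherel's theorem in the second variable. -/
theorem integrable_norm_sq_F2_and_integral_eq {f : ℝ × ℝ → ℂ} (hf : Continuous f)
    (hs : HasCompactSupport f) (x : ℝ) :
    Integrable (fun ξ => ‖F2 f x ξ‖ ^ 2) ∧ ∫ ξ, ‖F2 f x ξ‖ ^ 2 = ∫ b, ‖f (x, b)‖ ^ 2 := by
  have hc : Continuous fun b => f (x, b) := by fun_prop
  have hcs : HasCompactSupport fun b => f (x, b) :=
    hs.comp_isClosedEmbedding ⟨isEmbedding_prodMkRight x, by
      rw [show range (Prod.mk x) = (Prod.fst ⁻¹' {x} : Set (ℝ × ℝ)) by ext ⟨a, b⟩; simp [eq_comm]]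
      exact isClosed_singleton.preimage continuous_fst⟩
  rw [F2_eq_fourier]
  exact integrable_norm_sq_fourier_and_integral_eq (hc.integrable_of_hasCompactSupport hcs)
    (hc.memLp_of_hasCompactSupport hcs)

theorem stronglyMeasurable_F2 {f : ℝ × ℝ → ℂ} (hf : Continuous f) :
    StronglyMeasurable (fun p : ℝ × ℝ => F2 f p.1 p.2) := by
  unfold F2
  refine StronglyMeasurable.integral_prod_right (f := fun (p : ℝ × ℝ) (b : ℝ) =>
    f (p.1, b) * Complex.exp (-(2 * Real.pi * Complex.I * (b : ℂ) * (p.2 : ℂ)))) ?_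
  apply Continuous.stronglyMeasurable
  simp only [Function.uncurry_def]
  fun_prop

theorem integrable_norm_sq_div_sq {f : ℝ × ℝ → ℂ} (hf : Continuous f)
    (hs : HasCompactSupport f) (hin : tsupport f ⊆ Ioi (0 : ℝ) ×ˢ univ) :
    Integrable (fun p : ℝ × ℝ => ‖f p‖ ^ 2 / p.1 ^ 2) := by
  have hsub : tsupport (fun p : ℝ × ℝ => ‖f p‖ ^ 2 / p.1 ^ 2) ⊆ tsupport f := by
    refine closure_mono fun p hp => ?_
    contrapose! hp
    simp [Function.notMem_support.1 hp]
  refine Continuous.integrable_of_hasCompactSupport ?_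
    (hs.of_isClosed_subset (isClosed_tsupport _) hsub)
  refine continuous_of_tsupport fun p hp => ?_
  have hp0 : 0 < p.1 := (hin (hsub hp)).1
  exact (hf.norm.pow 2).continuousAt.div (by fun_prop) (by positivity)

theorem integral_kernel_eq (u : ℝ → ℝ) {s : ℝ} (hs : 0 < s) :
    ∫ t in Ioi (0 : ℝ), (s / t ^ 2) * u (t / s) = ∫ x in Ioi (0 : ℝ), u x / x ^ 2 := by
  have h := integral_comp_mul_left_Ioi' (fun t => (s / t ^ 2) * u (t / s)) 0 hs
  rw [mul_zero, smul_eq_mul] at h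
  rw [← h, ← integral_const_mul]
  refine setIntegral_congr_fun measurableSet_Ioi fun x hx => ?_
  have hx0 : x ≠ 0 := ne_of_gt hx
  rw [mul_div_cancel_left₀ _ hs.ne']
  field_simp

/-- Plancherel identity for the `ax+b` group `G = (0,∞) × ℝ` (left Haar measure `a⁻² da db`)
in kernel form: the sum of the squared Hilbert–Schmidt norms of the kernels of `f̂(π⁺)` and
`f̂(π⁻)` equals the squared norm of `f` in `L²(G, μ_L)`. -/
theorem axb_plancherel_kernel_form
    (f : ℝ × ℝ → ℂ) (hf_cont : Continuous f) (hf_supp : HasCompactSupport f)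
    (hf_in : tsupport f ⊆ Set.Ioi (0 : ℝ) ×ˢ Set.univ) :
    ((∫ s in Set.Ioi (0 : ℝ), ∫ t in Set.Ioi (0 : ℝ),
        (s / t ^ 2) * ‖F2 f (t / s) (-s)‖ ^ 2) +
      ∫ s in Set.Ioi (0 : ℝ), ∫ t in Set.Ioi (0 : ℝ),
        (s / t ^ 2) * ‖F2 f (t / s) s‖ ^ 2) =
      ∫ a in Set.Ioi (0 : ℝ), ∫ b : ℝ, ‖f (a, b)‖ ^ 2 / a ^ 2 := by
  have hpl := integrable_norm_sq_F2_and_integral_eq hf_cont hf_supp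
  have hint : Integrable (Function.uncurry fun x ξ : ℝ => ‖F2 f x ξ‖ ^ 2 / x ^ 2)
      ((volume.restrict (Ioi 0)).prod volume) := by
    have hmeas : StronglyMeasurable (Function.uncurry fun x ξ : ℝ => ‖F2 f x ξ‖ ^ 2 / x ^ 2) :=
      (((stronglyMeasurable_F2 hf_cont).norm.measurable.pow_const 2).div
        (measurable_fst.pow_const 2)).stronglyMeasurable
    rw [integrable_prod_iff hmeas.aestronglyMeasurable]
    refine ⟨.of_forall fun x => (hpl x).1.div_const (x ^ 2), ?_⟩
    have h := (integrable_norm_sq_div_sq hf_cont hf_supp hf_in).integral_prod_left.restrict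
      (s := Ioi 0)
    refine h.congr (.of_forall fun x => ?_)
    simp only [Function.uncurry_apply_pair, norm_div, norm_pow, integral_div, (hpl x).2,
      Real.norm_eq_abs, sq_abs]
  have hH := hint.integral_prod_right
  simp only [Function.uncurry_apply_pair] at hH
  have hneg : ∫ s in Ioi (0 : ℝ), ∫ t in Ioi (0 : ℝ), (s / t ^ 2) * ‖F2 f (t / s) (-s)‖ ^ 2 =
      ∫ s in Iic (0 : ℝ), ∫ x in Ioi (0 : ℝ), ‖F2 f x s‖ ^ 2 / x ^ 2 := by
    rw [← neg_zero, ← integral_comp_neg_Ioi, neg_zero]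
    exact setIntegral_congr_fun measurableSet_Ioi fun s hs =>
      integral_kernel_eq (fun x => ‖F2 f x (-s)‖ ^ 2) hs
  have hpos : ∫ s in Ioi (0 : ℝ), ∫ t in Ioi (0 : ℝ), (s / t ^ 2) * ‖F2 f (t / s) s‖ ^ 2 =
      ∫ s in Ioi (0 : ℝ), ∫ x in Ioi (0 : ℝ), ‖F2 f x s‖ ^ 2 / x ^ 2 :=
    setIntegral_congr_fun measurableSet_Ioi fun s hs =>
      integral_kernel_eq (fun x => ‖F2 f x s‖ ^ 2) hs
  rw [hneg, hpos, intervalIntegral.integral_Iic_add_Ioi hH.integrableOn hH.integrableOn,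
    ← integral_integral_swap hint]
  simp only [integral_div, (hpl _).2]
end

section
/- (Hörmander–Mikhlin multiplier theorem.) Let d ≥ 1 and let m : ℝ^d → ℂ be bounded and of class C^{⌊d/2⌋+1} on ℝ^d ∖ {0}, and suppose there is C_m > 0 such that for every multi-index α with 0 ≤ |α| ≤ ⌊d/2⌋+1 and every ξ ≠ 0, |ξ|^{|α|} · |∂^α m(ξ)| ≤ C_m. Then for every p with 1 < p < ∞ there is a constant C (depending only on d, p, C_m) such that for every Schwartz function f on ℝ^d, the function T_m f = 𝓕^{−1}( m · 𝓕 f ) satisfies ‖T_m f‖_{L^p(ℝ^d)} ≤ C · ‖f‖_{L^p(ℝ^d)}; i.e., m is an L^p Fourier multiplier. -/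
open MeasureTheory SchwartzMap
open scoped FourierTransform ENNReal

set_option linter.unusedSectionVars false

section HormanderMikhlin

open Set Filter Topology Metric Real
open scoped NNReal ContDiff

variable {V : Type*} [NormedAddCommGroup V] [InnerProductSpace ℝ V] [FiniteDimensional ℝ V]
  [MeasurableSpace V] [BorelSpace V]

/-! ### The Fourier transform on `L¹ ∩ L²` -/

theorem integral_fourier_mul_eq {f g : V → ℂ} (hf : Integrable f) (hg : Integrable g) :
    ∫ x, 𝓕 f x * g x = ∫ x, f x * 𝓕 g x := by
  have := VectorFourier.integral_fourierIntegral_smul_eq_flip (μ := (volume : Measure V))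
    (ν := (volume : Measure V)) (L := innerₗ V) (f := f) (g := g)
    Real.continuous_fourierChar continuous_inner hf hg
  rw [flip_innerₗ] at this
  exact this

theorem integral_fourierInv_mul_eq {f g : V → ℂ} (hf : Integrable f) (hg : Integrable g) :
    ∫ x, 𝓕⁻ f x * g x = ∫ x, f x * 𝓕⁻ g x := by
  have := VectorFourier.integral_fourierIntegral_smul_eq_flip (μ := (volume : Measure V))
    (ν := (volume : Measure V)) (L := -innerₗ V) (f := f) (g := g)
    Real.continuous_fourierChar continuous_inner.neg hf hg
  have h2 : (-innerₗ V).flip = -innerₗ V := by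
    ext x y; simp [real_inner_comm]
  rw [h2] at this
  exact this

theorem continuous_fourier_of_integrable {f : V → ℂ} (hf : Integrable f) : Continuous (𝓕 f) :=
  VectorFourier.fourierIntegral_continuous Real.continuous_fourierChar continuous_inner hf

theorem continuous_fourierInv_of_integrable {f : V → ℂ} (hf : Integrable f) :
    Continuous (𝓕⁻ f) :=
  VectorFourier.fourierIntegral_continuous Real.continuous_fourierChar continuous_inner.neg hf

theorem coeFn_fourier_toLp {f : V → ℂ} (hf : Integrable f) (hf2 : MemLp f 2) :
    (𝓕 (hf2.toLp f) : Lp (α := V) ℂ 2 volume) =ᵐ[volume] 𝓕 f := by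
  apply ae_eq_of_integral_contDiff_smul_eq
  · exact (Lp.memLp (μ := volume) _).locallyIntegrable (by norm_num)
  · exact (continuous_fourier_of_integrable hf).locallyIntegrable (μ := volume)
  intro g g_smooth g_cpt
  have hg₁ : HasCompactSupport (Complex.ofRealCLM ∘ g) := g_cpt.comp_left rfl
  have hg₂ : ContDiff ℝ ∞ (Complex.ofRealCLM ∘ g) := by fun_prop
  set G := hg₁.toSchwartzMap hg₂ with hG
  calc ∫ x, g x • (𝓕 (hf2.toLp f) : Lp (α := V) ℂ 2 volume) x
      = ((𝓕 (hf2.toLp f) : Lp (α := V) ℂ 2 volume) : 𝓢'(V, ℂ)) G := by simp [hG]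
    _ = ((hf2.toLp f : Lp (α := V) ℂ 2 volume) : 𝓢'(V, ℂ)) (𝓕 G) := by
        rw [← Lp.fourier_toTemperedDistribution_eq]; rfl
    _ = ∫ x, 𝓕 (G : V → ℂ) x * f x := by
        rw [Lp.toTemperedDistribution_apply]
        apply integral_congr_ae
        filter_upwards [hf2.coeFn_toLp] with x hx
        rw [hx, SchwartzMap.fourier_coe, smul_eq_mul]
    _ = ∫ x, g x • 𝓕 f x := by
        rw [integral_fourier_mul_eq G.integrable hf]
        simp [hG]

theorem coeFn_fourierInv_toLp {f : V → ℂ} (hf : Integrable f) (hf2 : MemLp f 2) :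
    (𝓕⁻ (hf2.toLp f) : Lp (α := V) ℂ 2 volume) =ᵐ[volume] 𝓕⁻ f := by
  apply ae_eq_of_integral_contDiff_smul_eq
  · exact (Lp.memLp (μ := volume) _).locallyIntegrable (by norm_num)
  · exact (continuous_fourierInv_of_integrable hf).locallyIntegrable (μ := volume)
  intro g g_smooth g_cpt
  have hg₁ : HasCompactSupport (Complex.ofRealCLM ∘ g) := g_cpt.comp_left rfl
  have hg₂ : ContDiff ℝ ∞ (Complex.ofRealCLM ∘ g) := by fun_prop
  set G := hg₁.toSchwartzMap hg₂ with hG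
  calc ∫ x, g x • (𝓕⁻ (hf2.toLp f) : Lp (α := V) ℂ 2 volume) x
      = ((𝓕⁻ (hf2.toLp f) : Lp (α := V) ℂ 2 volume) : 𝓢'(V, ℂ)) G := by simp [hG]
    _ = ((hf2.toLp f : Lp (α := V) ℂ 2 volume) : 𝓢'(V, ℂ)) (𝓕⁻ G) := by
        rw [← Lp.fourierInv_toTemperedDistribution_eq]; rfl
    _ = ∫ x, 𝓕⁻ (G : V → ℂ) x * f x := by
        rw [Lp.toTemperedDistribution_apply]
        apply integral_congr_ae
        filter_upwards [hf2.coeFn_toLp] with x hx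
        rw [hx, SchwartzMap.fourierInv_coe, smul_eq_mul]
    _ = ∫ x, g x • 𝓕⁻ f x := by
        rw [integral_fourierInv_mul_eq G.integrable hf]
        simp [hG]

theorem eLpNorm_fourierInv_eq {f : V → ℂ} (hf : Integrable f) (hf2 : MemLp f 2) :
    eLpNorm (𝓕⁻ f) 2 = eLpNorm f 2 := by
  rw [← eLpNorm_congr_ae (coeFn_fourierInv_toLp hf hf2), ← eLpNorm_congr_ae hf2.coeFn_toLp]
  have h : ‖(𝓕⁻ (hf2.toLp f) : Lp (α := V) ℂ 2 volume)‖ = ‖hf2.toLp f‖ :=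
    (Lp.fourierTransformₗᵢ V ℂ).symm.norm_map _
  rw [Lp.norm_def, Lp.norm_def] at h
  exact (ENNReal.toReal_eq_toReal_iff' (Lp.eLpNorm_ne_top _) (Lp.eLpNorm_ne_top _)).1 h

/-! ### Weighted `L¹` bounds for kernels with band-limited symbols -/

theorem lintegral_enorm_sq_eq {α : Type*} [MeasurableSpace α] {μ : Measure α} (f : α → ℂ) :
    ∫⁻ x, ‖f x‖ₑ ^ 2 ∂μ = eLpNorm f 2 μ ^ 2 := by
  have := eLpNorm_nnreal_pow_eq_lintegral (f := f) (μ := μ) (p := 2) (by norm_num)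
  simpa using this.symm

theorem lintegral_enorm_fourierInv_sq {f : V → ℂ} (hf : Integrable f) (hf2 : MemLp f 2) :
    ∫⁻ x, ‖𝓕⁻ f x‖ₑ ^ 2 = ∫⁻ x, ‖f x‖ₑ ^ 2 := by
  rw [lintegral_enorm_sq_eq, lintegral_enorm_sq_eq, eLpNorm_fourierInv_eq hf hf2]

theorem lintegral_enorm_fourier_sq {f : V → ℂ} (hf : Integrable f) (hf2 : MemLp f 2) :
    ∫⁻ x, ‖𝓕 f x‖ₑ ^ 2 = ∫⁻ x, ‖f x‖ₑ ^ 2 := by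
  rw [← lintegral_enorm_fourierInv_sq hf hf2, ← lintegral_neg_eq_self]
  simp_rw [Real.fourierInv_eq_fourier_neg]

theorem sq_lintegral_mul_le {α : Type*} [MeasurableSpace α] {μ : Measure α} {f g : α → ℝ≥0∞}
    (hf : AEMeasurable f μ) (hg : AEMeasurable g μ) :
    (∫⁻ x, f x * g x ∂μ) ^ 2 ≤ (∫⁻ x, f x ^ 2 ∂μ) * ∫⁻ x, g x ^ 2 ∂μ := by
  have h := ENNReal.lintegral_mul_le_Lp_mul_Lq μ Real.HolderConjugate.two_two hf hg
  have h2 := pow_le_pow_left₀ zero_le h 2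
  have key (a : ℝ≥0∞) : (a ^ (1 / 2 : ℝ)) ^ 2 = a := by
    rw [← ENNReal.rpow_natCast, ← ENNReal.rpow_mul]; norm_num
  rw [mul_pow, key, key] at h2
  simpa using h2

/-- Plancherel for directional derivatives. -/
theorem lintegral_inner_pow_mul_fourier_sq {N : ℕ} {n : V → ℂ} (hn : ContDiff ℝ N n)
    (hc : HasCompactSupport n) (v : V) :
    ∫⁻ x, ENNReal.ofReal ((2 * π * |inner ℝ x v|) ^ (2 * N)) * ‖𝓕 n x‖ₑ ^ 2
      = ∫⁻ x, ‖iteratedFDeriv ℝ N n x (fun _ => v)‖ₑ ^ 2 := by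
  have hcont (k : ℕ) (hk : k ≤ N) : Continuous (iteratedFDeriv ℝ k n) :=
    hn.continuous_iteratedFDeriv (by exact_mod_cast hk)
  have hni (k : ℕ) (hk : k ≤ N) : Integrable (iteratedFDeriv ℝ k n) :=
    (hcont k hk).integrable_of_hasCompactSupport (hc.iteratedFDeriv k)
  have h1 : 𝓕 (fun x => iteratedFDeriv ℝ N n x (fun _ => v))
      = fun w => (-(2 * π * Complex.I)) ^ N • ((-inner ℝ w v : ℝ) : ℂ) ^ N * 𝓕 n w := by
    ext w
    have h2 := congrFun (Real.fourier_iteratedFDeriv (N := N) (by exact_mod_cast hn)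
      (fun k hk => hni k (by exact_mod_cast hk)) (n := N) le_rfl) w
    have h3 := congrArg (fun L => L (fun _ => v)) h2
    simp only [VectorFourier.fourierPowSMulRight_apply] at h3
    rw [← Real.fourier_continuousMultilinearMap_apply]
    · rw [h3]; simp [mul_assoc]; exact Or.inl rfl
    · exact hni N le_rfl
  have hcN : Continuous (fun x => iteratedFDeriv ℝ N n x (fun _ => v)) := by
    have := hcont N le_rfl
    fun_prop
  have hsN : HasCompactSupport (fun x => iteratedFDeriv ℝ N n x (fun _ => v)) :=
    (hc.iteratedFDeriv N).comp_left
      (g := fun L : ContinuousMultilinearMap ℝ (fun _ : Fin N => V) ℂ => L (fun _ => v)) rfl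
  rw [← lintegral_enorm_fourier_sq (hcN.integrable_of_hasCompactSupport hsN)
    (hcN.memLp_of_hasCompactSupport hsN), h1]
  refine lintegral_congr fun x => ?_
  rw [← ofReal_norm, ← ofReal_norm, ← ENNReal.ofReal_pow (by positivity),
    ← ENNReal.ofReal_pow (by positivity), ← ENNReal.ofReal_mul (by positivity)]
  congr 1
  simp [abs_of_pos pi_pos]
  ring

theorem one_add_mul_norm_pow_le (N : ℕ) :
    ∃ C : ℝ, 0 ≤ C ∧ ∀ R : ℝ, 0 ≤ R → ∀ x : V, (1 + R * ‖x‖) ^ (2 * N) ≤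
      C * (1 + R ^ (2 * N) * ∑ k, (2 * π * |inner ℝ x (stdOrthonormalBasis ℝ V k)|) ^ (2 * N)) := by
  rcases N.eq_zero_or_pos with rfl | hN
  · exact ⟨1, zero_le_one, fun R hR x => by simp⟩
  set D := Module.finrank ℝ V
  obtain ⟨M, hM⟩ : ∃ M, 2 * N = M + 1 := ⟨2 * N - 1, by omega⟩
  refine ⟨2 ^ M * (D + 1) ^ M, by positivity, fun R hR x => ?_⟩
  set b := stdOrthonormalBasis ℝ V
  set s := ∑ k, |inner ℝ x (b k)|
  have h1 : ‖x‖ ≤ s := by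
    conv_lhs => rw [← b.sum_repr' x]
    refine (norm_sum_le _ _).trans (Finset.sum_le_sum fun k _ => ?_)
    rw [norm_smul, b.norm_eq_one, mul_one, real_inner_comm, Real.norm_eq_abs]
  have hs : 0 ≤ s := (norm_nonneg x).trans h1
  have h2 : s ^ (2 * N) ≤ (D + 1) ^ M * ∑ k, (2 * π * |inner ℝ x (b k)|) ^ (2 * N) := by
    have h3 := pow_sum_div_card_le_sum_pow (s := Finset.univ) (f := fun k => |inner ℝ x (b k)|)
      (fun k _ => abs_nonneg _) M
    have h4 : s ^ (M + 1) ≤ (D + 1) ^ M * (s ^ (M + 1) / (D : ℝ) ^ M) := by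
      rcases Nat.eq_zero_or_pos D with h0 | h0
      · have : s = 0 := by
          have : IsEmpty (Fin (Module.finrank ℝ V)) := by
            change IsEmpty (Fin D); rw [h0]; infer_instance
          simp [s]
        simp [this]
      · rw [mul_div_assoc', le_div_iff₀ (by positivity), mul_comm]
        gcongr
        linarith
    rw [hM]
    refine h4.trans ?_
    gcongr
    simp only [Finset.card_univ, Fintype.card_fin] at h3
    refine h3.trans (Finset.sum_le_sum fun k _ => ?_)
    gcongr
    have := Real.pi_gt_three
    nlinarith [abs_nonneg (inner ℝ x (b k))]
  calc (1 + R * ‖x‖) ^ (2 * N) ≤ (1 + R * s) ^ (2 * N) := by gcongr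
    _ ≤ 2 ^ M * (1 ^ (2 * N) + (R * s) ^ (2 * N)) := by
        have := add_pow_le (zero_le_one (α := ℝ)) (mul_nonneg hR hs) (2 * N)
        rwa [show 2 * N - 1 = M by omega] at this
    _ = 2 ^ M * (1 + R ^ (2 * N) * s ^ (2 * N)) := by rw [mul_pow, one_pow]
    _ ≤ 2 ^ M * ((D + 1) ^ M * 1 + R ^ (2 * N) *
          ((D + 1) ^ M * ∑ k, (2 * π * |inner ℝ x (b k)|) ^ (2 * N))) := by
        gcongr
        rw [mul_one]
        exact one_le_pow₀ (by linarith [(Nat.cast_nonneg D : (0 : ℝ) ≤ D)])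
    _ = _ := by ring

theorem lintegral_one_add_mul_norm_rpow {R : ℝ} (hR : 0 < R) (s : ℝ) :
    ∫⁻ x : V, ENNReal.ofReal ((1 + R * ‖x‖) ^ s) =
      ENNReal.ofReal ((R ^ Module.finrank ℝ V)⁻¹) *
        ∫⁻ x : V, ENNReal.ofReal ((1 + ‖x‖) ^ s) := by
  have h := lintegral_map_equiv (μ := (volume : Measure V))
    (fun x : V => ENNReal.ofReal ((1 + ‖x‖) ^ s))
    (Homeomorph.smulOfNeZero R hR.ne').toMeasurableEquiv
  have h2 : ((Homeomorph.smulOfNeZero R hR.ne').toMeasurableEquiv : V → V) = fun x => R • x := rfl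
  rw [h2, Measure.map_addHaar_smul _ hR.ne', lintegral_smul_measure] at h
  rw [abs_of_pos (by positivity)] at h
  rw [← smul_eq_mul, h]
  simp [norm_smul, abs_of_pos hR]

/-- A symbol at frequency scale `R` with `N > dim / 2` controlled derivatives has a kernel which is
integrable, with some decay, at the spatial scale `R⁻¹`. -/
theorem exists_lintegral_fourier_weight_le {N : ℕ} (hN : Module.finrank ℝ V + 1 ≤ 2 * N) :
    ∃ C : ℝ≥0, ∀ (R : ℝ), 0 < R → ∀ (A : ℝ), 0 ≤ A → ∀ n : V → ℂ, ContDiff ℝ N n →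
      (∀ ξ, n ξ ≠ 0 → ‖ξ‖ ≤ 2 * R) → (∀ ξ, ‖n ξ‖ ≤ A) →
      (∀ ξ, R ^ N * ‖iteratedFDeriv ℝ N n ξ‖ ≤ A) →
      ∫⁻ x, ENNReal.ofReal ((1 + R * ‖x‖) ^ (1 / 4 : ℝ)) * ‖𝓕 n x‖ₑ ≤ C * ENNReal.ofReal A := by
  set D := Module.finrank ℝ V with hD
  obtain ⟨C₁, hC₁, hweight⟩ := one_add_mul_norm_pow_le (V := V) N
  set I := ∫⁻ x : V, ENNReal.ofReal ((1 + ‖x‖) ^ (-(2 * N - 1 / 2 : ℝ))) with hI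
  have hIfin : I ≠ ⊤ := by
    refine (finite_integral_one_add_norm ?_).ne
    have : (D + 1 : ℝ) ≤ 2 * N := by exact_mod_cast hN
    linarith
  set v₁ := (volume : Measure V) (ball 0 1)
  have hv₁ : v₁ ≠ ⊤ := measure_ball_lt_top.ne
  set B : ℝ≥0∞ := I * (ENNReal.ofReal C₁ * ((1 + D) * (ENNReal.ofReal (2 ^ D) * v₁)))
  have hB : B ≠ ⊤ := by
    refine ENNReal.mul_ne_top hIfin (ENNReal.mul_ne_top ENNReal.ofReal_ne_top
      (ENNReal.mul_ne_top ?_ (ENNReal.mul_ne_top ENNReal.ofReal_ne_top hv₁)))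
    exact ENNReal.add_ne_top.2 ⟨ENNReal.one_ne_top, ENNReal.natCast_ne_top _⟩
  refine ⟨(B ^ (1 / 2 : ℝ)).toNNReal, fun R hR A hA n hn hsupp h0 hder => ?_⟩
  have hBs : ((B ^ (1 / 2 : ℝ)).toNNReal : ℝ≥0∞) ^ 2 = B := by
    rw [ENNReal.coe_toNNReal (ENNReal.rpow_ne_top_of_nonneg (by norm_num) hB),
      ← ENNReal.rpow_natCast, ← ENNReal.rpow_mul]
    norm_num
  have htsupp : tsupport n ⊆ closedBall 0 (2 * R) :=
    closure_minimal (fun ξ hξ => by simpa using hsupp ξ hξ) isClosed_closedBall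
  have hc : HasCompactSupport n := HasCompactSupport.of_support_subset_isCompact
    (isCompact_closedBall 0 (2 * R)) ((subset_tsupport n).trans htsupp)
  have hni : Integrable n := hn.continuous.integrable_of_hasCompactSupport hc
  have hn2 : MemLp n 2 := hn.continuous.memLp_of_hasCompactSupport hc
  have hcont : Continuous (𝓕 n) := continuous_fourier_of_integrable hni
  have hvol : (volume : Measure V) (closedBall 0 (2 * R)) = ENNReal.ofReal ((2 * R) ^ D) * v₁ :=
    Measure.addHaar_closedBall _ _ (by positivity)
  have hball (g : V → ℂ) (a : ℝ) (hg : ∀ ξ, ‖g ξ‖ ≤ a)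
      (hgs : ∀ ξ, ξ ∉ closedBall (0 : V) (2 * R) → g ξ = 0) :
      ∫⁻ x, ‖g x‖ₑ ^ 2 ≤ ENNReal.ofReal (a ^ 2) * (ENNReal.ofReal ((2 * R) ^ D) * v₁) := by
    have ha : 0 ≤ a := (norm_nonneg _).trans (hg 0)
    calc ∫⁻ x, ‖g x‖ₑ ^ 2
        ≤ ∫⁻ x, (closedBall (0 : V) (2 * R)).indicator (fun _ => ENNReal.ofReal (a ^ 2)) x := by
          refine lintegral_mono fun x => ?_
          by_cases hx : x ∈ closedBall (0 : V) (2 * R)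
          · rw [indicator_of_mem hx, ← ofReal_norm, ← ENNReal.ofReal_pow (norm_nonneg _)]
            exact ENNReal.ofReal_le_ofReal (pow_le_pow_left₀ (norm_nonneg _) (hg x) 2)
          · simp [hgs x hx]
      _ = _ := by rw [lintegral_indicator_const measurableSet_closedBall, hvol]
  set b := stdOrthonormalBasis ℝ V
  have hK0 : ∫⁻ x, ‖𝓕 n x‖ₑ ^ 2 ≤
      ENNReal.ofReal (A ^ 2) * (ENNReal.ofReal ((2 * R) ^ D) * v₁) := by
    rw [lintegral_enorm_fourier_sq hni hn2]
    refine hball n A h0 fun ξ hξ => ?_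
    by_contra h
    exact hξ (by simpa using hsupp ξ h)
  have hKk (k : Fin D) : ENNReal.ofReal (R ^ (2 * N)) *
      ∫⁻ x, ENNReal.ofReal ((2 * π * |inner ℝ x (b k)|) ^ (2 * N)) * ‖𝓕 n x‖ₑ ^ 2 ≤
      ENNReal.ofReal (A ^ 2) * (ENNReal.ofReal ((2 * R) ^ D) * v₁) := by
    rw [lintegral_inner_pow_mul_fourier_sq hn hc]
    have h1 := hball (fun x => iteratedFDeriv ℝ N n x (fun _ => b k)) (A / R ^ N) (fun ξ => by
      rw [le_div_iff₀ (by positivity), mul_comm]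
      refine le_trans ?_ (hder ξ)
      gcongr
      refine ((iteratedFDeriv ℝ N n ξ).le_opNorm _).trans (le_of_eq ?_)
      simp [b.norm_eq_one]) (fun ξ hξ => by
      have : ξ ∉ tsupport (iteratedFDeriv ℝ N n) := fun h =>
        hξ (htsupp (tsupport_iteratedFDeriv_subset N h))
      simp [image_eq_zero_of_notMem_tsupport this])
    refine (mul_le_mul_right h1 _).trans (le_of_eq ?_)
    rw [← mul_assoc, ← ENNReal.ofReal_mul (by positivity)]
    congr 2
    field_simp
    ring
  have hL2 : ∫⁻ x, (ENNReal.ofReal ((1 + R * ‖x‖) ^ N) * ‖𝓕 n x‖ₑ) ^ 2 ≤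
      ENNReal.ofReal C₁ * ((1 + D) *
        (ENNReal.ofReal (A ^ 2) * (ENNReal.ofReal ((2 * R) ^ D) * v₁))) := by
    calc ∫⁻ x, (ENNReal.ofReal ((1 + R * ‖x‖) ^ N) * ‖𝓕 n x‖ₑ) ^ 2
        ≤ ∫⁻ x, ENNReal.ofReal C₁ * (‖𝓕 n x‖ₑ ^ 2 + ∑ k, ENNReal.ofReal (R ^ (2 * N)) *
            (ENNReal.ofReal ((2 * π * |inner ℝ x (b k)|) ^ (2 * N)) * ‖𝓕 n x‖ₑ ^ 2)) := by
          refine lintegral_mono fun x => ?_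
          rw [mul_pow, ← ENNReal.ofReal_pow (by positivity), ← pow_mul, mul_comm N 2]
          refine (mul_le_mul_left (ENNReal.ofReal_le_ofReal (hweight R hR.le x)) _).trans ?_
          rw [ENNReal.ofReal_mul hC₁, mul_assoc, ENNReal.ofReal_add zero_le_one (by positivity),
            ENNReal.ofReal_mul (by positivity),
            ENNReal.ofReal_sum_of_nonneg (fun _ _ => by positivity), add_mul, ENNReal.ofReal_one,
            one_mul, mul_assoc, Finset.sum_mul, Finset.mul_sum]
      _ = ENNReal.ofReal C₁ * ((∫⁻ x, ‖𝓕 n x‖ₑ ^ 2) + ∑ k, ENNReal.ofReal (R ^ (2 * N)) *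
            ∫⁻ x, ENNReal.ofReal ((2 * π * |inner ℝ x (b k)|) ^ (2 * N)) * ‖𝓕 n x‖ₑ ^ 2) := by
          rw [lintegral_const_mul' _ _ ENNReal.ofReal_ne_top, lintegral_add_left (by fun_prop),
            lintegral_finsetSum _ (fun k _ => by fun_prop)]
          simp_rw [lintegral_const_mul' _ _ ENNReal.ofReal_ne_top]
      _ ≤ ENNReal.ofReal C₁ * (ENNReal.ofReal (A ^ 2) * (ENNReal.ofReal ((2 * R) ^ D) * v₁) +
            ∑ _k : Fin D, ENNReal.ofReal (A ^ 2) * (ENNReal.ofReal ((2 * R) ^ D) * v₁)) := by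
          exact mul_le_mul_right (add_le_add hK0 (Finset.sum_le_sum fun k _ => hKk k)) _
      _ = _ := by
          rw [Finset.sum_const, Finset.card_univ, Fintype.card_fin, nsmul_eq_mul]
          ring
  have hCS : (∫⁻ x, ENNReal.ofReal ((1 + R * ‖x‖) ^ (1 / 4 : ℝ)) * ‖𝓕 n x‖ₑ) ^ 2 ≤
      B * ENNReal.ofReal A ^ 2 := by
    calc (∫⁻ x, ENNReal.ofReal ((1 + R * ‖x‖) ^ (1 / 4 : ℝ)) * ‖𝓕 n x‖ₑ) ^ 2
        = (∫⁻ x, ENNReal.ofReal ((1 + R * ‖x‖) ^ (1 / 4 - N : ℝ)) *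
            (ENNReal.ofReal ((1 + R * ‖x‖) ^ N) * ‖𝓕 n x‖ₑ)) ^ 2 := by
          congr 1
          refine lintegral_congr fun x => ?_
          rw [← mul_assoc, ← ENNReal.ofReal_mul (by positivity), ← Real.rpow_natCast,
            ← Real.rpow_add (by positivity)]
          norm_num
      _ ≤ (∫⁻ x, ENNReal.ofReal ((1 + R * ‖x‖) ^ (1 / 4 - N : ℝ)) ^ 2) *
            ∫⁻ x, (ENNReal.ofReal ((1 + R * ‖x‖) ^ N) * ‖𝓕 n x‖ₑ) ^ 2 :=
          sq_lintegral_mul_le (by fun_prop) (by fun_prop)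
      _ = (ENNReal.ofReal ((R ^ D)⁻¹) * I) *
            ∫⁻ x, (ENNReal.ofReal ((1 + R * ‖x‖) ^ N) * ‖𝓕 n x‖ₑ) ^ 2 := by
          rw [hI, hD, ← lintegral_one_add_mul_norm_rpow hR]
          congr 1
          refine lintegral_congr fun x => ?_
          rw [← ENNReal.ofReal_pow (by positivity), ← Real.rpow_natCast,
            ← Real.rpow_mul (by positivity)]
          congr 2
          push_cast
          ring
      _ ≤ (ENNReal.ofReal ((R ^ D)⁻¹) * I) * (ENNReal.ofReal C₁ * ((1 + D) *
            (ENNReal.ofReal (A ^ 2) * (ENNReal.ofReal ((2 * R) ^ D) * v₁)))) := by gcongr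
      _ = (ENNReal.ofReal ((R ^ D)⁻¹) * ENNReal.ofReal (R ^ D)) *
            (B * ENNReal.ofReal A ^ 2) := by
          rw [mul_pow, ENNReal.ofReal_mul (by positivity), ENNReal.ofReal_pow hA]
          ring
      _ = B * ENNReal.ofReal A ^ 2 := by
          rw [← ENNReal.ofReal_mul (by positivity), inv_mul_cancel₀ (by positivity)]
          simp
  rw [← hBs, ← mul_pow] at hCS
  exact (ENNReal.pow_le_pow_left_iff two_ne_zero).1 hCS

/-- A symbol of class `C^N` supported in the ball of radius `2R`, all of whose derivatives of order
at most `N` are bounded by `A` at the scale `R`. -/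
structure BandBound (N : ℕ) (R A : ℝ) (n : V → ℂ) : Prop where
  contDiff : ContDiff ℝ N n
  norm_le : ∀ ξ, n ξ ≠ 0 → ‖ξ‖ ≤ 2 * R
  bound : ∀ i ≤ N, ∀ ξ, R ^ i * ‖iteratedFDeriv ℝ i n ξ‖ ≤ A

namespace BandBound

variable {N : ℕ} {R A : ℝ} {n : V → ℂ}

theorem nonneg (h : BandBound N R A n) : 0 ≤ A := by
  have := h.bound 0 (Nat.zero_le _) 0
  simp only [pow_zero, one_mul] at this
  exact (norm_nonneg _).trans this

theorem norm_apply_le (h : BandBound N R A n) (ξ : V) : ‖n ξ‖ ≤ A := by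
  simpa using h.bound 0 (Nat.zero_le _) ξ

theorem tsupport_subset (h : BandBound N R A n) : tsupport n ⊆ closedBall 0 (2 * R) :=
  closure_minimal (fun ξ hξ => by simpa using h.norm_le ξ hξ) isClosed_closedBall

theorem hasCompactSupport (h : BandBound N R A n) : HasCompactSupport n :=
  HasCompactSupport.of_support_subset_isCompact (isCompact_closedBall 0 (2 * R))
    ((subset_tsupport n).trans h.tsupport_subset)

theorem integrable (h : BandBound N R A n) : Integrable n :=
  h.contDiff.continuous.integrable_of_hasCompactSupport h.hasCompactSupport

theorem memLp (h : BandBound N R A n) : MemLp n 2 :=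
  h.contDiff.continuous.memLp_of_hasCompactSupport h.hasCompactSupport

theorem mul (h : BandBound N R A n) (hR : 0 ≤ R) {U : Set V} (hU : IsOpen U) {g : V → ℂ} {B : ℝ}
    (hsub : tsupport n ⊆ U) (hg : ContDiffOn ℝ N g U)
    (hgB : ∀ i ≤ N, ∀ ξ ∈ tsupport n, R ^ i * ‖iteratedFDerivWithin ℝ i g U ξ‖ ≤ B)
    (hB : 0 ≤ B) : BandBound N R (2 ^ N * B * A) (fun ξ => g ξ * n ξ) := by
  have hA := h.nonneg
  have hts : tsupport (fun ξ => g ξ * n ξ) ⊆ tsupport n :=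
    closure_mono fun ξ hξ => right_ne_zero_of_mul hξ
  refine ⟨contDiff_iff_contDiffAt.2 fun ξ => ?_, fun ξ hξ => h.norm_le ξ (right_ne_zero_of_mul hξ),
    fun i hi ξ => ?_⟩
  · by_cases hξ : ξ ∈ tsupport n
    · exact (hg.contDiffAt (hU.mem_nhds (hsub hξ))).mul h.contDiff.contDiffAt
    · have : (fun ξ => g ξ * n ξ) =ᶠ[𝓝 ξ] fun _ => 0 := by
        filter_upwards [(isClosed_tsupport n).isOpen_compl.mem_nhds hξ] with x hx
        simp [image_eq_zero_of_notMem_tsupport hx]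
      exact contDiffAt_const.congr_of_eventuallyEq this
  · by_cases hξ : ξ ∈ tsupport n
    · have hiN : (i : ℕ∞ω) ≤ N := by exact_mod_cast hi
      have h1 := norm_iteratedFDerivWithin_mul_le hg h.contDiff.contDiffOn hU.uniqueDiffOn
        (hsub hξ) hiN
      rw [iteratedFDerivWithin_of_isOpen i hU (hsub hξ)] at h1
      calc R ^ i * ‖iteratedFDeriv ℝ i (fun ξ => g ξ * n ξ) ξ‖
          ≤ R ^ i * ∑ k ∈ Finset.range (i + 1), (i.choose k : ℝ) *
              ‖iteratedFDerivWithin ℝ k g U ξ‖ * ‖iteratedFDerivWithin ℝ (i - k) n U ξ‖ := by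
            gcongr
        _ ≤ ∑ k ∈ Finset.range (i + 1), (i.choose k : ℝ) * (B * A) := by
            rw [Finset.mul_sum]
            refine Finset.sum_le_sum fun k hk => ?_
            have hk' : k ≤ i := Nat.lt_succ_iff.1 (Finset.mem_range.1 hk)
            have h2 := hgB k (hk'.trans hi) ξ hξ
            have h3 := h.bound (i - k) ((Nat.sub_le _ _).trans hi) ξ
            rw [iteratedFDerivWithin_of_isOpen (i - k) hU (hsub hξ)]
            calc _ = (i.choose k : ℝ) * ((R ^ k * ‖iteratedFDerivWithin ℝ k g U ξ‖) *
                  (R ^ (i - k) * ‖iteratedFDeriv ℝ (i - k) n ξ‖)) := by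
                  rw [← Nat.add_sub_cancel' hk', pow_add]
                  simp only [add_tsub_cancel_left]
                  ring
              _ ≤ _ := by gcongr
        _ = 2 ^ i * (B * A) := by
            rw [← Finset.sum_mul]
            congr 1
            exact_mod_cast Nat.sum_range_choose i
        _ ≤ 2 ^ N * B * A := by
            rw [mul_assoc]
            gcongr
            norm_num
    · have : iteratedFDeriv ℝ i (fun ξ => g ξ * n ξ) ξ = 0 :=
        image_eq_zero_of_notMem_tsupport
          fun h' => hξ (hts (tsupport_iteratedFDeriv_subset i h'))
      simp only [this, norm_zero, mul_zero]
      positivity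

end BandBound

theorem iteratedDeriv_cexp_mul_ofReal (c : ℂ) (i : ℕ) :
    iteratedDeriv i (fun t : ℝ => Complex.exp (c * t)) = fun t : ℝ => c ^ i * Complex.exp (c * t) := by
  induction i with
  | zero => simp
  | succ i ih =>
    rw [iteratedDeriv_succ, ih]
    funext t
    have h : HasDerivAt (fun t : ℝ => c * (t : ℂ)) c t := by
      simpa using (Complex.ofRealCLM.hasDerivAt (x := t)).const_mul c
    rw [((h.cexp).const_mul (c ^ i)).deriv]
    ring

theorem pow_mul_norm_iteratedFDeriv_modulation_le {N : ℕ} {R : ℝ} (hR : 0 < R) {h : V}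
    (hh : R * ‖h‖ ≤ 1) {i : ℕ} (hi : i ≤ N) {ξ : V} (hξ : ‖ξ‖ ≤ 2 * R) :
    R ^ i * ‖iteratedFDeriv ℝ i
      (fun ξ : V => Complex.exp (2 * π * Complex.I * (inner ℝ h ξ : ℝ)) - 1) ξ‖ ≤
      4 * π * (2 * π) ^ N * (R * ‖h‖) := by
  have hpi : 1 ≤ 2 * π := by linarith [Real.pi_gt_three]
  have hRh : 0 ≤ R * ‖h‖ := by positivity
  rcases Nat.eq_zero_or_pos i with rfl | hpos
  · have h1 : ‖Complex.exp (2 * π * Complex.I * (inner ℝ h ξ : ℝ)) - 1‖ ≤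
        ‖2 * π * inner ℝ h ξ‖ := by
      refine le_trans (le_of_eq ?_) Real.norm_exp_I_mul_ofReal_sub_one_le
      push_cast
      ring_nf
    have h2 : |inner ℝ h ξ| ≤ ‖h‖ * (2 * R) := (abs_real_inner_le_norm h ξ).trans (by gcongr)
    simp only [pow_zero, one_mul, norm_iteratedFDeriv_zero]
    refine h1.trans ?_
    rw [norm_mul, Real.norm_of_nonneg (by positivity), Real.norm_eq_abs]
    calc 2 * π * |inner ℝ h ξ| ≤ 2 * π * (‖h‖ * (2 * R)) := by gcongr
      _ = 4 * π * 1 * (R * ‖h‖) := by ring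
      _ ≤ _ := by
        gcongr
        exact one_le_pow₀ hpi
  · set E : ℝ → ℂ := fun t => Complex.exp (2 * π * Complex.I * t) with hE
    have hEc : ContDiff ℝ i E := by
      have : ContDiff ℝ i (fun t : ℝ => (t : ℂ)) := Complex.ofRealCLM.contDiff
      fun_prop
    have hcomp : (fun ξ : V => Complex.exp (2 * π * Complex.I * (inner ℝ h ξ : ℝ))) =
        E ∘ (innerSL ℝ h) := by
      ext; simp [hE]
    have hcd : ContDiff ℝ i (E ∘ (innerSL ℝ h)) := hEc.comp (innerSL ℝ h).contDiff
    have hsub : iteratedFDeriv ℝ i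
        (fun ξ : V => Complex.exp (2 * π * Complex.I * (inner ℝ h ξ : ℝ)) - 1) ξ =
        iteratedFDeriv ℝ i (E ∘ (innerSL ℝ h)) ξ := by
      have h1 := iteratedFDeriv_sub_apply (x := ξ) hcd.contDiffAt
        (contDiffAt_const (c := (1 : ℂ)))
      rw [iteratedFDeriv_const_of_ne hpos.ne', Pi.zero_apply, sub_zero, ← hcomp] at h1
      rw [← hcomp, ← h1]
      rfl
    have hEn (t : ℝ) : ‖iteratedFDeriv ℝ i E t‖ = (2 * π) ^ i := by
      rw [norm_iteratedFDeriv_eq_norm_iteratedDeriv, hE, iteratedDeriv_cexp_mul_ofReal, norm_mul,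
        norm_pow]
      have : ‖Complex.exp (2 * π * Complex.I * t)‖ = 1 := by
        rw [show (2 * π * Complex.I * t : ℂ) = ((2 * π * t : ℝ) : ℂ) * Complex.I by push_cast; ring]
        exact Complex.norm_exp_ofReal_mul_I _
      rw [this]
      simp [abs_of_pos Real.pi_pos]
    rw [hsub, (innerSL ℝ h).iteratedFDeriv_comp_right hEc ξ le_rfl]
    calc R ^ i * ‖(iteratedFDeriv ℝ i E (innerSL ℝ h ξ)).compContinuousLinearMap
          fun _ => innerSL ℝ h‖ ≤ R ^ i * ((2 * π) ^ i * ‖h‖ ^ i) := by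
          gcongr
          refine (ContinuousMultilinearMap.norm_compContinuousLinearMap_le _ _).trans ?_
          rw [hEn]
          simp
      _ = (2 * π) ^ i * (R * ‖h‖) ^ i := by ring
      _ ≤ (2 * π) ^ N * (R * ‖h‖) ^ 1 := by
          exact mul_le_mul (pow_le_pow_right₀ hpi hi) (pow_le_pow_of_le_one hRh hh hpos)
            (by positivity) (by positivity)
      _ ≤ 4 * π * (2 * π) ^ N * (R * ‖h‖) := by
          rw [pow_one]
          gcongr
          refine le_mul_of_one_le_left (by positivity) (by linarith)

theorem BandBound.modulation {N : ℕ} {R A : ℝ} {n : V → ℂ} (hn : BandBound N R A n) (hR : 0 < R)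
    {h : V} (hh : R * ‖h‖ ≤ 1) :
    BandBound N R (2 ^ N * (4 * π * (2 * π) ^ N * (R * ‖h‖)) * A)
      (fun ξ => (Complex.exp (2 * π * Complex.I * (inner ℝ h ξ : ℝ)) - 1) * n ξ) := by
  refine hn.mul hR.le isOpen_univ (subset_univ _) ?_ (fun i hi ξ hξ => ?_) (by positivity)
  · refine ContDiff.contDiffOn ?_
    have h1 : ContDiff ℝ N (fun ξ : V => ((inner ℝ h ξ : ℝ) : ℂ)) :=
      Complex.ofRealCLM.contDiff.comp (contDiff_const.inner ℝ contDiff_id)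
    fun_prop
  · rw [iteratedFDerivWithin_univ]
    exact pow_mul_norm_iteratedFDeriv_modulation_le hR hh hi
      (by simpa using hn.tsupport_subset hξ)

theorem sum_Icc_int_telescope (a : ℤ → ℂ) (J : ℕ) :
    ∑ j ∈ Finset.Icc (-J : ℤ) J, (a j - a (j - 1)) = a J - a (-J - 1) := by
  have key (n : ℤ) (hn : (-J : ℤ) - 1 ≤ n) :
      ∑ j ∈ Finset.Icc (-J : ℤ) n, (a j - a (j - 1)) = a n - a (-J - 1) := by
    induction n, hn using Int.leInduction with
    | base => simp
    | succ n hn ih =>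
      have : Finset.Icc (-J : ℤ) (n + 1) = insert (n + 1) (Finset.Icc (-J : ℤ) n) := by
        ext; simp; omega
      rw [this, Finset.sum_insert (by simp), ih]
      simp
  exact key J (by omega)

/-- A smooth dyadic partition of unity on the frequency side. -/
theorem exists_dyadic_cutoff (N : ℕ) : ∃ (φ : V → ℂ) (A : ℝ),
    (∀ R, 0 < R → BandBound N R A (fun ξ => φ (R⁻¹ • ξ))) ∧
    (∀ R, 0 < R → ∀ ξ ∈ tsupport (fun ξ => φ (R⁻¹ • ξ)), R / 2 ≤ ‖ξ‖) ∧
    (∀ (J : ℕ) ξ, ‖∑ j ∈ Finset.Icc (-J : ℤ) J, φ (((2 : ℝ) ^ j)⁻¹ • ξ)‖ ≤ 1) ∧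
    ∀ ξ, ξ ≠ 0 → Tendsto (fun J : ℕ => ∑ j ∈ Finset.Icc (-J : ℤ) J, φ (((2 : ℝ) ^ j)⁻¹ • ξ))
      atTop (𝓝 1) := by
  let χ : ContDiffBump (0 : V) := ⟨1, 2, one_pos, one_lt_two⟩
  have hχ1 {ξ : V} (h : ‖ξ‖ ≤ 1) : χ ξ = 1 := χ.one_of_mem_closedBall (by simpa using h)
  have hχ0 {ξ : V} (h : 2 ≤ ‖ξ‖) : χ ξ = 0 := χ.zero_of_le_dist (by simpa using h)
  set φ : V → ℂ := fun ξ => ((χ ξ - χ ((2 : ℝ) • ξ) : ℝ) : ℂ) with hφ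
  have hφs (ξ : V) (h : φ ξ ≠ 0) : 1 / 2 ≤ ‖ξ‖ ∧ ‖ξ‖ ≤ 2 := by
    constructor
    · by_contra! h'
      refine h ?_
      simp only [hφ]
      rw [hχ1 (by linarith), hχ1 (by rw [norm_smul]; norm_num; linarith)]
      simp
    · by_contra! h'
      refine h ?_
      simp only [hφ]
      rw [hχ0 (by linarith), hχ0 (by rw [norm_smul]; norm_num; linarith)]
      simp
  have hφc : ContDiff ℝ N φ :=
    Complex.ofRealCLM.contDiff.comp (χ.contDiff.sub (χ.contDiff.comp (contDiff_const_smul _)))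
  have hcs : HasCompactSupport φ := HasCompactSupport.of_support_subset_isCompact
    (isCompact_closedBall 0 2) (fun ξ hξ => by simpa using (hφs ξ hξ).2)
  have hbd (i : ℕ) (hi : i ≤ N) : ∃ C, ∀ ξ, ‖iteratedFDeriv ℝ i φ ξ‖ ≤ C :=
    (hcs.iteratedFDeriv i).exists_bound_of_continuous
      (hφc.continuous_iteratedFDeriv (by exact_mod_cast hi))
  choose! C hC using hbd
  have htele (J : ℕ) (ξ : V) : ∑ j ∈ Finset.Icc (-J : ℤ) J, φ (((2 : ℝ) ^ j)⁻¹ • ξ) =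
      ((χ (((2 : ℝ) ^ (J : ℤ))⁻¹ • ξ) - χ (((2 : ℝ) ^ (-J - 1 : ℤ))⁻¹ • ξ) : ℝ) : ℂ) := by
    rw [Complex.ofReal_sub,
      ← sum_Icc_int_telescope (fun j : ℤ => ((χ (((2 : ℝ) ^ j)⁻¹ • ξ) : ℝ) : ℂ))]
    refine Finset.sum_congr rfl fun j _ => ?_
    simp only [hφ, Complex.ofReal_sub, smul_smul]
    congr 4
    rw [zpow_sub_one₀ two_ne_zero, mul_inv, inv_inv, mul_comm]
  refine ⟨φ, ∑ i ∈ Finset.range (N + 1), C i, fun R hR => ⟨?_, fun ξ hξ => ?_, fun i hi ξ => ?_⟩,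
    fun R hR ξ hξ => ?_, fun J ξ => ?_, fun ξ hξ => ?_⟩
  · exact hφc.comp (contDiff_const_smul _)
  · have := (hφs _ hξ).2
    rw [norm_smul, norm_inv, Real.norm_of_nonneg hR.le, inv_mul_le_iff₀ hR] at this
    linarith
  · have hCnn (i : ℕ) (hi : i ≤ N) : 0 ≤ C i := (norm_nonneg _).trans (hC i hi 0)
    have hciN : ContDiff ℝ i φ := hφc.of_le (by exact_mod_cast hi)
    rw [iteratedFDeriv_comp_const_smul _ hciN, norm_smul, norm_pow, norm_inv,
      Real.norm_of_nonneg hR.le, ← mul_assoc, inv_pow, mul_inv_cancel₀ (by positivity), one_mul]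
    refine (hC i hi _).trans (Finset.single_le_sum (f := C) (fun k hk => hCnn k ?_) ?_)
    · exact Nat.lt_succ_iff.1 (Finset.mem_range.1 hk)
    · exact Finset.mem_range.2 (Nat.lt_succ_of_le hi)
  · have hcl : IsClosed {ξ : V | R / 2 ≤ ‖ξ‖} := isClosed_le continuous_const continuous_norm
    refine closure_minimal (fun ξ hξ => ?_) hcl hξ
    have := (hφs _ hξ).1
    rw [norm_smul, norm_inv, Real.norm_of_nonneg hR.le, le_inv_mul_iff₀ hR] at this
    simp only [mem_ofPred_eq]
    linarith
  · rw [htele, Complex.norm_real, Real.norm_eq_abs, abs_le]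
    constructor <;> linarith [χ.nonneg (x := ((2 : ℝ) ^ (J : ℤ))⁻¹ • ξ),
      χ.le_one (x := ((2 : ℝ) ^ (J : ℤ))⁻¹ • ξ), χ.nonneg (x := ((2 : ℝ) ^ (-J - 1 : ℤ))⁻¹ • ξ),
      χ.le_one (x := ((2 : ℝ) ^ (-J - 1 : ℤ))⁻¹ • ξ)]
  · have hξ' : 0 < ‖ξ‖ := norm_pos_iff.2 hξ
    have h2 : Tendsto (fun J : ℕ => (2 : ℝ) ^ J) atTop atTop :=
      tendsto_pow_atTop_atTop_of_one_lt one_lt_two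
    refine tendsto_const_nhds.congr' ?_
    filter_upwards [h2.eventually_ge_atTop ‖ξ‖, h2.eventually_ge_atTop (2 / ‖ξ‖)] with J h3 h4
    rw [htele, hχ1, hχ0]
    · simp
    · rw [norm_smul, norm_inv, norm_zpow, ← zpow_neg]
      rw [div_le_iff₀ hξ'] at h4
      refine h4.trans ?_
      gcongr
      rw [← zpow_natCast]
      simp only [Real.norm_ofNat]
      exact zpow_le_zpow_right₀ one_le_two (by omega)
    · rw [norm_smul, norm_inv, norm_zpow, inv_mul_le_iff₀ (zpow_pos (by simp) _)]
      simpa using h3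

/-- Localising a Mikhlin symbol to a dyadic shell. -/
theorem BandBound.mikhlin_mul {N : ℕ} {R A M : ℝ} {n m : V → ℂ} (hn : BandBound N R A n)
    (hR : 0 < R) (hlow : ∀ ξ ∈ tsupport n, R / 2 ≤ ‖ξ‖) (hm : ContDiffOn ℝ N m {0}ᶜ)
    (hM : ∀ i ≤ N, ∀ ξ, ξ ≠ 0 → ‖ξ‖ ^ i * ‖iteratedFDerivWithin ℝ i m {0}ᶜ ξ‖ ≤ M)
    (hM0 : 0 ≤ M) : BandBound N R (2 ^ N * (2 ^ N * M) * A) (fun ξ => m ξ * n ξ) := by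
  have h0 (ξ : V) (hξ : ξ ∈ tsupport n) : ξ ≠ 0 := by
    rintro rfl
    have := hlow 0 hξ
    rw [norm_zero] at this
    linarith
  refine hn.mul hR.le isOpen_compl_singleton (fun ξ hξ => h0 ξ hξ) hm (fun i hi ξ hξ => ?_)
    (by positivity)
  have h1 := hlow ξ hξ
  calc R ^ i * ‖iteratedFDerivWithin ℝ i m {0}ᶜ ξ‖
      ≤ (2 * ‖ξ‖) ^ i * ‖iteratedFDerivWithin ℝ i m {0}ᶜ ξ‖ := by
        gcongr
        linarith
    _ = 2 ^ i * (‖ξ‖ ^ i * ‖iteratedFDerivWithin ℝ i m {0}ᶜ ξ‖) := by ring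
    _ ≤ 2 ^ N * M := mul_le_mul (pow_le_pow_right₀ one_le_two hi) (hM i hi ξ (h0 ξ hξ))
        (by positivity) (by positivity)

theorem fourierInv_apply_eq_integral (n : V → ℂ) (x : V) :
    𝓕⁻ n x = ∫ ξ, Complex.exp (2 * π * Complex.I * (inner ℝ x ξ : ℝ)) * n ξ := by
  rw [Real.fourierInv_eq']
  refine integral_congr_ae (.of_forall fun ξ => ?_)
  simp only [smul_eq_mul, real_inner_comm x ξ]
  congr 2
  push_cast
  ring

theorem integrable_cexp_mul {n : V → ℂ} (hn : Integrable n) (x : V) :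
    Integrable fun ξ => Complex.exp (2 * π * Complex.I * (inner ℝ x ξ : ℝ)) * n ξ := by
  refine hn.bdd_mul (c := 1) (Continuous.aestronglyMeasurable (by fun_prop))
    (.of_forall fun ξ => le_of_eq ?_)
  rw [show (2 * π * Complex.I * (inner ℝ x ξ : ℝ) : ℂ) =
    ((2 * π * inner ℝ x ξ : ℝ) : ℂ) * Complex.I by push_cast; ring]
  exact Complex.norm_exp_ofReal_mul_I _

theorem fourierInv_add_sub {n : V → ℂ} (hn : Integrable n) (x h : V) :
    𝓕⁻ n (x + h) - 𝓕⁻ n x =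
      𝓕⁻ (fun ξ => (Complex.exp (2 * π * Complex.I * (inner ℝ h ξ : ℝ)) - 1) * n ξ) x := by
  rw [fourierInv_apply_eq_integral, fourierInv_apply_eq_integral, fourierInv_apply_eq_integral,
    ← integral_sub (integrable_cexp_mul hn _) (integrable_cexp_mul hn _)]
  refine integral_congr_ae (.of_forall fun ξ => ?_)
  simp only [inner_add_left, Complex.ofReal_add, mul_add, Complex.exp_add]
  ring

theorem fourierInv_mul_fourier_eq_integral {n b : V → ℂ} (hn : Integrable n) (hb : Integrable b)
    (x : V) : 𝓕⁻ (fun ξ => n ξ * 𝓕 b ξ) x = ∫ y, b y * 𝓕⁻ n (x - y) := by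
  rw [fourierInv_apply_eq_integral]
  have h := integral_fourier_mul_eq hb (integrable_cexp_mul hn x)
  calc _ = ∫ ξ, 𝓕 b ξ * (Complex.exp (2 * π * Complex.I * (inner ℝ x ξ : ℝ)) * n ξ) := by
        refine integral_congr_ae (.of_forall fun ξ => ?_)
        simp only
        ring
    _ = _ := by
        rw [h]
        refine integral_congr_ae (.of_forall fun y => ?_)
        simp only
        congr 1
        rw [fourierInv_apply_eq_integral, Real.fourier_eq']
        refine integral_congr_ae (.of_forall fun ξ => ?_)
        simp only [smul_eq_mul, inner_sub_left, ← mul_assoc, ← Complex.exp_add]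
        congr 2
        rw [real_inner_comm y ξ]
        push_cast
        ring

/-- Decay and smoothness, in mean, of the kernel of a symbol localised at frequency scale `R`. -/
theorem exists_kernel_bounds {N : ℕ} (hN : Module.finrank ℝ V + 1 ≤ 2 * N) :
    ∃ C : ℝ≥0, ∀ (R A : ℝ) (n : V → ℂ), 0 < R → BandBound N R A n →
      (∀ s, 0 < s → ∫⁻ x in (closedBall 0 s)ᶜ, ‖𝓕⁻ n x‖ₑ ≤
        C * ENNReal.ofReal A * ENNReal.ofReal ((R * s) ^ (-(1 / 4) : ℝ))) ∧
      ∀ h : V, ∫⁻ x, ‖𝓕⁻ n (x + h) - 𝓕⁻ n x‖ₑ ≤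
        C * ENNReal.ofReal A * ENNReal.ofReal (R * ‖h‖) := by
  obtain ⟨C, hC⟩ := exists_lintegral_fourier_weight_le (V := V) hN
  have hw (R A : ℝ) (n : V → ℂ) (hR : 0 < R) (hn : BandBound N R A n) :
      ∫⁻ x, ENNReal.ofReal ((1 + R * ‖x‖) ^ (1 / 4 : ℝ)) * ‖𝓕⁻ n x‖ₑ ≤ C * ENNReal.ofReal A := by
    refine le_trans (le_of_eq ?_)
      (hC R hR A hn.nonneg n hn.contDiff hn.norm_le hn.norm_apply_le (hn.bound N le_rfl))
    rw [← lintegral_neg_eq_self]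
    refine lintegral_congr fun x => ?_
    rw [Real.fourierInv_eq_fourier_neg, neg_neg, norm_neg]
  have hw1 (R A : ℝ) (n : V → ℂ) (hR : 0 < R) (hn : BandBound N R A n) :
      ∫⁻ x, ‖𝓕⁻ n x‖ₑ ≤ C * ENNReal.ofReal A := by
    refine le_trans (lintegral_mono fun x => ?_) (hw R A n hR hn)
    refine le_mul_of_one_le_left (by simp) ?_
    rw [ENNReal.one_le_ofReal]
    exact Real.one_le_rpow (le_add_of_nonneg_right (by positivity)) (by norm_num)
  set M : ℝ≥0 := Real.toNNReal (2 ^ N * (4 * π * (2 * π) ^ N)) with hM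
  refine ⟨C * (1 + 1 + M), fun R A n hR hn => ⟨fun s hs => ?_, fun h => ?_⟩⟩
  · calc ∫⁻ x in (closedBall 0 s)ᶜ, ‖𝓕⁻ n x‖ₑ
        ≤ ∫⁻ x in (closedBall 0 s)ᶜ, ENNReal.ofReal ((R * s) ^ (-(1 / 4) : ℝ)) *
            (ENNReal.ofReal ((1 + R * ‖x‖) ^ (1 / 4 : ℝ)) * ‖𝓕⁻ n x‖ₑ) := by
          refine setLIntegral_mono' measurableSet_closedBall.compl fun x hx => ?_
          rw [← mul_assoc]
          refine le_mul_of_one_le_left (by simp) ?_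
          rw [← ENNReal.ofReal_mul (by positivity), ENNReal.one_le_ofReal,
            Real.rpow_neg (by positivity), ← div_eq_inv_mul, one_le_div (by positivity)]
          have hx' : s < ‖x‖ := by simpa using hx
          refine Real.rpow_le_rpow (by positivity) ?_ (by norm_num)
          nlinarith
      _ ≤ ENNReal.ofReal ((R * s) ^ (-(1 / 4) : ℝ)) * (C * ENNReal.ofReal A) := by
          rw [lintegral_const_mul' _ _ ENNReal.ofReal_ne_top]
          exact mul_le_mul_right ((setLIntegral_le_lintegral _ _).trans (hw R A n hR hn)) _
      _ = (C * 1) * ENNReal.ofReal A * ENNReal.ofReal ((R * s) ^ (-(1 / 4) : ℝ)) := by ring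
      _ ≤ _ := by
          push_cast
          gcongr
          rw [add_assoc]
          exact le_self_add
  · rcases le_or_gt (R * ‖h‖) 1 with hh | hh
    · simp_rw [fourierInv_add_sub hn.integrable]
      refine (hw1 R _ _ hR (hn.modulation hR hh)).trans ?_
      have : ENNReal.ofReal (2 ^ N * (4 * π * (2 * π) ^ N * (R * ‖h‖)) * A) =
          M * ENNReal.ofReal A * ENNReal.ofReal (R * ‖h‖) := by
        rw [hM, ENNReal.ofNNReal_toNNReal, ← ENNReal.ofReal_mul (by positivity),
          ← ENNReal.ofReal_mul (mul_nonneg (by positivity) hn.nonneg)]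
        congr 1
        ring
      rw [this, ← mul_assoc, ← mul_assoc]
      push_cast
      gcongr
      exact le_add_self
    · have hK : Continuous (𝓕⁻ n) := continuous_fourierInv_of_integrable hn.integrable
      calc ∫⁻ x, ‖𝓕⁻ n (x + h) - 𝓕⁻ n x‖ₑ ≤ ∫⁻ x, (‖𝓕⁻ n (x + h)‖ₑ + ‖𝓕⁻ n x‖ₑ) :=
            lintegral_mono fun x => enorm_sub_le
        _ = (∫⁻ x, ‖𝓕⁻ n x‖ₑ) + ∫⁻ x, ‖𝓕⁻ n x‖ₑ := by
            have hm : Measurable fun x => ‖𝓕⁻ n (x + h)‖ₑ :=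
              (hK.comp (continuous_add_const h)).enorm.measurable
            rw [lintegral_add_left hm]
            congr 1
            exact lintegral_add_right_eq_self (fun x => ‖𝓕⁻ n x‖ₑ) h
        _ ≤ C * ENNReal.ofReal A + C * ENNReal.ofReal A :=
            add_le_add (hw1 R A n hR hn) (hw1 R A n hR hn)
        _ = (C * (1 + 1)) * ENNReal.ofReal A * 1 := by ring
        _ ≤ _ := by
            refine mul_le_mul' (mul_le_mul_left ?_ _) (ENNReal.one_le_ofReal.2 hh.le)
            push_cast
            exact mul_le_mul_right le_self_add _

/-- A frequency-localised multiplier acting on a mean-zero function supported in a ball, measured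
away from that ball. -/
theorem exists_bandOperator_atom_bound {N : ℕ} (hN : Module.finrank ℝ V + 1 ≤ 2 * N) :
    ∃ C : ℝ≥0, ∀ (R A : ℝ) (n : V → ℂ), 0 < R → BandBound N R A n →
      ∀ (b : V → ℂ) (c : V) (r : ℝ), 0 < r → Integrable b → (∀ y ∉ closedBall c r, b y = 0) →
      ∫ y, b y = 0 →
      ∫⁻ x in (closedBall c (2 * r))ᶜ, ‖𝓕⁻ (fun ξ => n ξ * 𝓕 b ξ) x‖ₑ ≤
        C * ENNReal.ofReal A * ENNReal.ofReal (min (R * r) ((R * r) ^ (-(1 / 4) : ℝ))) *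
          ∫⁻ y, ‖b y‖ₑ := by
  obtain ⟨C, hC⟩ := exists_kernel_bounds (V := V) hN
  refine ⟨C, fun R A n hR hn b c r hr hb hbs hb0 => ?_⟩
  obtain ⟨htail, hdiff⟩ := hC R A n hR hn
  have hK : Continuous (𝓕⁻ n) := continuous_fourierInv_of_integrable hn.integrable
  have hKbd (x : V) : ‖𝓕⁻ n x‖ ≤ ∫ ξ, ‖n ξ‖ := by
    rw [Real.fourierInv_eq_fourier_neg]
    exact VectorFourier.norm_fourierIntegral_le_integral_norm _ _ _ _ _
  have hbK (x : V) : Integrable fun y => b y * 𝓕⁻ n (x - y) :=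
    hb.mul_bdd (Continuous.aestronglyMeasurable (by fun_prop)) (.of_forall fun y => hKbd (x - y))
  have hswap (S : Set V) (F : V → V → ℂ) (hF : Continuous (Function.uncurry F)) (B : ℝ≥0∞)
      (h1 : ∀ x, ‖𝓕⁻ (fun ξ => n ξ * 𝓕 b ξ) x‖ₑ ≤ ∫⁻ y, ‖b y‖ₑ * ‖F x y‖ₑ)
      (h2 : ∀ y ∈ closedBall c r, ∫⁻ x in S, ‖F x y‖ₑ ≤ B) :
      ∫⁻ x in S, ‖𝓕⁻ (fun ξ => n ξ * 𝓕 b ξ) x‖ₑ ≤ B * ∫⁻ y, ‖b y‖ₑ := by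
    calc ∫⁻ x in S, ‖𝓕⁻ (fun ξ => n ξ * 𝓕 b ξ) x‖ₑ
        ≤ ∫⁻ x in S, ∫⁻ y, ‖b y‖ₑ * ‖F x y‖ₑ := lintegral_mono h1
      _ = ∫⁻ y, ∫⁻ x in S, ‖b y‖ₑ * ‖F x y‖ₑ := by
          refine lintegral_lintegral_swap ?_
          refine AEMeasurable.mul ?_ hF.enorm.measurable.aemeasurable
          exact (hb.aestronglyMeasurable.enorm).comp_snd
      _ ≤ ∫⁻ y, B * ‖b y‖ₑ := by
          refine lintegral_mono fun y => ?_
          simp only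
          rw [lintegral_const_mul' _ _ enorm_ne_top, mul_comm]
          by_cases hy : y ∈ closedBall c r
          · exact mul_le_mul_left (h2 y hy) _
          · simp [hbs y hy]
      _ = _ := lintegral_const_mul'' _ hb.aestronglyMeasurable.enorm
  have hmain1 : ∫⁻ x in (closedBall c (2 * r))ᶜ, ‖𝓕⁻ (fun ξ => n ξ * 𝓕 b ξ) x‖ₑ ≤
      C * ENNReal.ofReal A * ENNReal.ofReal (R * r) * ∫⁻ y, ‖b y‖ₑ := by
    refine hswap _ (fun x y => 𝓕⁻ n (x - y) - 𝓕⁻ n (x - c)) (by fun_prop) _ (fun x => ?_)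
      fun y hy => ?_
    · rw [fourierInv_mul_fourier_eq_integral hn.integrable hb]
      have : ∫ y, b y * 𝓕⁻ n (x - y) = ∫ y, b y * (𝓕⁻ n (x - y) - 𝓕⁻ n (x - c)) := by
        simp_rw [mul_sub]
        rw [integral_sub (hbK x) (hb.mul_const _), integral_mul_const, hb0, zero_mul, sub_zero]
      rw [this]
      refine (enorm_integral_le_lintegral_enorm _).trans (le_of_eq ?_)
      simp_rw [enorm_mul]
    · refine (setLIntegral_le_lintegral _ _).trans ?_
      have h1 := hdiff (c - y)
      rw [← lintegral_sub_right_eq_self _ c] at h1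
      have h2 (x : V) : x - c + (c - y) = x - y := by abel
      simp_rw [h2] at h1
      refine h1.trans ?_
      gcongr
      rw [← dist_eq_norm, dist_comm]
      exact hy
  have hmain2 : ∫⁻ x in (closedBall c (2 * r))ᶜ, ‖𝓕⁻ (fun ξ => n ξ * 𝓕 b ξ) x‖ₑ ≤
      C * ENNReal.ofReal A * ENNReal.ofReal ((R * r) ^ (-(1 / 4) : ℝ)) * ∫⁻ y, ‖b y‖ₑ := by
    refine hswap _ (fun x y => 𝓕⁻ n (x - y)) (by fun_prop) _ (fun x => ?_) fun y hy => ?_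
    · rw [fourierInv_mul_fourier_eq_integral hn.integrable hb]
      refine (enorm_integral_le_lintegral_enorm _).trans (le_of_eq ?_)
      simp_rw [enorm_mul]
    · refine le_trans ?_ (htail r hr)
      rw [← lintegral_indicator measurableSet_closedBall.compl,
        ← lintegral_indicator measurableSet_closedBall.compl,
        ← lintegral_sub_right_eq_self (fun x => (closedBall (0 : V) r)ᶜ.indicator _ x) y]
      refine lintegral_mono fun x => ?_
      by_cases hx : x ∈ closedBall c (2 * r)
      · simp [hx]
      · rw [indicator_of_mem (by exact hx), indicator_of_mem]
        simp only [mem_compl_iff, mem_closedBall, not_le, dist_zero_right] at hx hy ⊢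
        have := dist_triangle x y c
        rw [← dist_eq_norm]
        linarith
  rcases min_choice (R * r) ((R * r) ^ (-(1 / 4) : ℝ)) with h | h <;> rw [h]
  exacts [hmain1, hmain2]

/-- `T` is the Fourier multiplier with symbol `m` on `L²`. -/
def IsL2Multiplier (m : V → ℂ) (T : Lp (α := V) ℂ 2 volume →L[ℂ] Lp (α := V) ℂ 2 volume) : Prop :=
  ∀ u, (𝓕 (T u) : Lp (α := V) ℂ 2 volume) =ᵐ[volume] fun ξ =>
    m ξ * (𝓕 u : Lp (α := V) ℂ 2 volume) ξ

theorem memLp_mul_of_norm_le {m u : V → ℂ} {M : ℝ} (hm : AEStronglyMeasurable m)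
    (hM : ∀ ξ, ‖m ξ‖ ≤ M) (hu : MemLp u 2) : MemLp (fun ξ => m ξ * u ξ) 2 :=
  hu.of_le_mul (c := M) (hm.mul hu.1)
    (.of_forall fun ξ => by rw [norm_mul]; exact mul_le_mul_of_nonneg_right (hM ξ) (norm_nonneg _))

theorem exists_isL2Multiplier {m : V → ℂ} {M : ℝ} (hm : AEStronglyMeasurable m)
    (hM : ∀ ξ, ‖m ξ‖ ≤ M) : ∃ T, IsL2Multiplier m T := by
  have hmem (u : Lp (α := V) ℂ 2 volume) := memLp_mul_of_norm_le hm hM (Lp.memLp u)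
  let L₀ : Lp (α := V) ℂ 2 volume →ₗ[ℂ] Lp (α := V) ℂ 2 volume :=
    { toFun := fun u => (hmem u).toLp _
      map_add' := fun u v => by
        rw [← MemLp.toLp_add]
        refine MemLp.toLp_congr _ _ ?_
        filter_upwards [Lp.coeFn_add u v] with ξ h
        simp only [Pi.add_apply, h]
        ring
      map_smul' := fun c u => by
        rw [RingHom.id_apply, ← MemLp.toLp_const_smul]
        refine MemLp.toLp_congr _ _ ?_
        filter_upwards [Lp.coeFn_smul c u] with ξ h
        simp only [Pi.smul_apply, h, smul_eq_mul]
        ring }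
  let L : Lp (α := V) ℂ 2 volume →L[ℂ] Lp (α := V) ℂ 2 volume := L₀.mkContinuous M fun u => by
    refine Lp.norm_le_mul_norm_of_ae_le_mul ?_
    filter_upwards [(hmem u).coeFn_toLp] with ξ h
    change ‖((hmem u).toLp _ : Lp (α := V) ℂ 2 volume) ξ‖ ≤ _
    rw [h, norm_mul]
    exact mul_le_mul_of_nonneg_right (hM ξ) (norm_nonneg _)
  let F := (Lp.fourierTransformₗᵢ V ℂ).toContinuousLinearEquiv
  refine ⟨F.symm.toContinuousLinearMap ∘L L ∘L F.toContinuousLinearMap, fun u => ?_⟩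
  have h1 : (𝓕 ((F.symm.toContinuousLinearMap ∘L L ∘L F.toContinuousLinearMap) u) :
      Lp (α := V) ℂ 2 volume) = (hmem (𝓕 u)).toLp _ := F.apply_symm_apply _
  rw [h1]
  exact (hmem _).coeFn_toLp

namespace IsL2Multiplier

variable {m : V → ℂ} {M : ℝ} {T : Lp (α := V) ℂ 2 volume →L[ℂ] Lp (α := V) ℂ 2 volume}

theorem norm_apply_le (hT : IsL2Multiplier m T) (hM : ∀ ξ, ‖m ξ‖ ≤ M)
    (u : Lp (α := V) ℂ 2 volume) : ‖T u‖ ≤ M * ‖u‖ := by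
  rw [← Lp.norm_fourier_eq (T u), ← Lp.norm_fourier_eq u]
  refine Lp.norm_le_mul_norm_of_ae_le_mul ?_
  filter_upwards [hT u] with ξ h
  rw [h, norm_mul]
  exact mul_le_mul_of_nonneg_right (hM ξ) (norm_nonneg _)

theorem coeFn_apply_toLp (hT : IsL2Multiplier m T) (hm : AEStronglyMeasurable m)
    (hM : ∀ ξ, ‖m ξ‖ ≤ M) {b : V → ℂ} (hb : Integrable b) (hb2 : MemLp b 2)
    (hi : Integrable fun ξ => m ξ * 𝓕 b ξ) :
    (T (hb2.toLp b) : V → ℂ) =ᵐ[volume] 𝓕⁻ fun ξ => m ξ * 𝓕 b ξ := by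
  have h2 : MemLp (𝓕 b) 2 :=
    (memLp_congr_ae (coeFn_fourier_toLp hb hb2)).1 (Lp.memLp _)
  have hmem := memLp_mul_of_norm_le hm hM h2
  have h3 : (𝓕 (T (hb2.toLp b)) : Lp (α := V) ℂ 2 volume) = hmem.toLp _ := by
    refine Lp.ext ?_
    filter_upwards [hT (hb2.toLp b), coeFn_fourier_toLp hb hb2, hmem.coeFn_toLp] with ξ h4 h5 h6
    rw [h4, h5, h6]
  have h4 : T (hb2.toLp b) = (𝓕⁻ (hmem.toLp _) : Lp (α := V) ℂ 2 volume) := by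
    rw [← h3]
    exact (FourierTransform.fourierInv_fourier_eq _).symm
  rw [h4]
  exact coeFn_fourierInv_toLp hi hmem

theorem inner_apply (hT : IsL2Multiplier m T)
    {T' : Lp (α := V) ℂ 2 volume →L[ℂ] Lp (α := V) ℂ 2 volume}
    (hT' : IsL2Multiplier (fun ξ => starRingEnd ℂ (m ξ)) T') (u v : Lp (α := V) ℂ 2 volume) :
    inner ℂ (T u) v = inner ℂ u (T' v) := by
  rw [← Lp.inner_fourier_eq (T u), ← Lp.inner_fourier_eq u, L2.inner_def, L2.inner_def]
  refine integral_congr_ae ?_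
  filter_upwards [hT u, hT' v] with ξ h1 h2
  rw [h1, h2]
  simp [RCLike.inner_apply]
  ring

theorem tendsto_apply (hT : IsL2Multiplier m T) {σ : ℕ → V → ℂ}
    {S : ℕ → Lp (α := V) ℂ 2 volume →L[ℂ] Lp (α := V) ℂ 2 volume}
    (hS : ∀ J, IsL2Multiplier (σ J) (S J)) (hσ : ∀ J ξ, ‖σ J ξ‖ ≤ M) (hm : ∀ ξ, ‖m ξ‖ ≤ M)
    (hlim : ∀ᵐ ξ, Tendsto (fun J => σ J ξ) atTop (𝓝 (m ξ))) (u : Lp (α := V) ℂ 2 volume) :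
    Tendsto (fun J => S J u) atTop (𝓝 (T u)) := by
  let F := (Lp.fourierTransformₗᵢ V ℂ).toContinuousLinearEquiv
  suffices h : Tendsto (fun J => F (S J u)) atTop (𝓝 (F (T u))) by
    have := (F.symm.continuous.tendsto _).comp h
    simpa [Function.comp_def] using this
  rw [Lp.tendsto_Lp_iff_tendsto_eLpNorm']
  set v : Lp (α := V) ℂ 2 volume := 𝓕 u with hv
  have hM0 : 0 ≤ M := (norm_nonneg _).trans (hm 0)
  have h1 (J : ℕ) : eLpNorm (⇑(F (S J u)) - ⇑(F (T u))) 2 volume =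
      (∫⁻ ξ, ‖σ J ξ * v ξ - m ξ * v ξ‖ₑ ^ 2) ^ (1 / 2 : ℝ) := by
    rw [eLpNorm_eq_lintegral_rpow_enorm_toReal two_ne_zero ENNReal.ofNat_ne_top]
    simp only [ENNReal.toReal_ofNat, ENNReal.rpow_ofNat]
    congr 1
    refine lintegral_congr_ae ?_
    filter_upwards [hT u, hS J u] with ξ h1 h2
    have h1' : F (T u) ξ = m ξ * v ξ := h1
    have h2' : F (S J u) ξ = σ J ξ * v ξ := h2
    simp only [Pi.sub_apply, h1', h2']
  simp_rw [h1]
  have h2 : Tendsto (fun J => ∫⁻ ξ, ‖σ J ξ * v ξ - m ξ * v ξ‖ₑ ^ 2) atTop (𝓝 0) := by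
    have h0 : (0 : ℝ≥0∞) = ∫⁻ _ : V, 0 := by simp
    rw [h0]
    refine tendsto_lintegral_of_dominated_convergence'
      (fun ξ => ENNReal.ofReal (2 * M) ^ 2 * ‖v ξ‖ₑ ^ 2) (fun J => ?_) (fun J => ?_) ?_ ?_
    · have : AEStronglyMeasurable (fun ξ => σ J ξ * v ξ - m ξ * v ξ) volume := by
        refine AEStronglyMeasurable.congr
          ((Lp.aestronglyMeasurable (F (S J u))).sub (Lp.aestronglyMeasurable (F (T u)))) ?_
        filter_upwards [hT u, hS J u] with ξ h1 h2
        have h1' : F (T u) ξ = m ξ * v ξ := h1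
        have h2' : F (S J u) ξ = σ J ξ * v ξ := h2
        simp only [Pi.sub_apply, h1', h2']
      exact this.enorm.pow_const 2
    · refine .of_forall fun ξ => ?_
      beta_reduce
      rw [← sub_mul, enorm_mul, mul_pow]
      gcongr
      rw [← ofReal_norm]
      refine ENNReal.ofReal_le_ofReal ((norm_sub_le _ _).trans ?_)
      linarith [hσ J ξ, hm ξ]
    · rw [lintegral_const_mul' _ _ (by finiteness), lintegral_enorm_sq_eq]
      exact ENNReal.mul_ne_top (by finiteness) (ENNReal.pow_ne_top (Lp.eLpNorm_ne_top v))
    · filter_upwards [hlim] with ξ hξ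
      have h3 : Tendsto (fun J => σ J ξ * v ξ - m ξ * v ξ) atTop (𝓝 0) := by
        simpa using (hξ.mul_const (v ξ)).sub_const (m ξ * v ξ)
      have h4 := (ENNReal.continuous_pow 2).tendsto _ |>.comp (continuous_enorm.tendsto _ |>.comp h3)
      simpa [Function.comp_def] using h4
  have h3 := (ENNReal.continuous_rpow_const (y := (1 / 2 : ℝ))).tendsto _ |>.comp h2
  simpa [Function.comp_def] using h3

end IsL2Multiplier

theorem lintegral_enorm_le_of_tendsto_Lp {u : ℕ → Lp (α := V) ℂ 2 volume}
    {v : Lp (α := V) ℂ 2 volume} (h : Tendsto u atTop (𝓝 v)) {S : Set V} {B : ℝ≥0∞}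
    (hB : ∀ n, ∫⁻ x in S, ‖u n x‖ₑ ≤ B) : ∫⁻ x in S, ‖v x‖ₑ ≤ B := by
  obtain ⟨ns, -, hns⟩ := (tendstoInMeasure_of_tendsto_Lp h).exists_seq_tendsto_ae
  calc ∫⁻ x in S, ‖v x‖ₑ = ∫⁻ x in S, liminf (fun i => ‖u (ns i) x‖ₑ) atTop := by
        refine lintegral_congr_ae (ae_restrict_of_ae ?_)
        filter_upwards [hns] with x hx
        exact ((continuous_enorm.tendsto _).comp hx).liminf_eq.symm
    _ ≤ liminf (fun i => ∫⁻ x in S, ‖u (ns i) x‖ₑ) atTop :=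
        lintegral_liminf_le' fun i => (Lp.aestronglyMeasurable (u (ns i))).enorm.restrict
    _ ≤ B := liminf_le_of_le (by isBoundedDefault) fun b hb => by
        obtain ⟨i, hi⟩ := hb.exists
        exact hi.trans (hB _)

theorem exists_tsum_dyadic_min_le : ∃ C : ℝ≥0, ∀ r : ℝ, 0 < r →
    ∑' j : ℤ, ENNReal.ofReal (min ((2 : ℝ) ^ j * r) (((2 : ℝ) ^ j * r) ^ (-(1 / 4) : ℝ))) ≤ C := by
  set q : ℝ := (2 : ℝ) ^ (-(1 / 4) : ℝ) with hq
  have hq0 : 0 < q := by positivity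
  have hq1 : q < 1 := Real.rpow_lt_one_of_one_lt_of_neg one_lt_two (by norm_num)
  have hgeo (a : ℝ) (ha0 : 0 ≤ a) (ha1 : a < 1) : ∑' n : ℕ, ENNReal.ofReal a ^ n ≠ ⊤ := by
    rw [ENNReal.tsum_geometric]
    refine ENNReal.inv_ne_top.2 (tsub_pos_of_lt ?_).ne'
    rw [ENNReal.ofReal_lt_one]
    exact ha1
  refine ⟨((∑' n : ℕ, ENNReal.ofReal q ^ n) + ∑' n : ℕ, ENNReal.ofReal (1 / 2) ^ n).toNNReal,
    fun r hr => ?_⟩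
  rw [ENNReal.coe_toNNReal (ENNReal.add_ne_top.2 ⟨hgeo q hq0.le hq1, hgeo _ (by norm_num) (by norm_num)⟩)]
  obtain ⟨k, hk1, hk2⟩ := exists_mem_Ico_zpow hr one_lt_two
  set s : ℝ := (2 : ℝ) ^ (-k) * r with hs
  have h2k : (0 : ℝ) < 2 ^ k := by positivity
  have hs1 : 1 ≤ s := by rw [hs, zpow_neg, le_inv_mul_iff₀ h2k]; simpa using hk1
  have hs2 : s < 2 := by
    rw [hs, zpow_neg, inv_mul_lt_iff₀ h2k, ← zpow_add_one₀ two_ne_zero]; exact hk2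
  rw [← (Equiv.subRight k).tsum_eq]
  have hre (j : ℤ) : (2 : ℝ) ^ (Equiv.subRight k j) * r = 2 ^ j * s := by
    rw [hs, ← mul_assoc, ← zpow_add₀ two_ne_zero, Equiv.subRight_apply, sub_eq_add_neg]
  simp_rw [hre]
  rw [tsum_of_nat_of_neg_add_one ENNReal.summable ENNReal.summable]
  refine add_le_add (ENNReal.tsum_le_tsum fun n => ?_) (ENNReal.tsum_le_tsum fun n => ?_)
  · rw [← ENNReal.ofReal_pow hq0.le]
    refine ENNReal.ofReal_le_ofReal ((min_le_right _ _).trans ?_)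
    rw [hq, ← Real.rpow_natCast, ← Real.rpow_mul zero_le_two, mul_comm _ (n : ℝ),
      Real.rpow_mul zero_le_two, Real.rpow_natCast, zpow_natCast]
    refine Real.rpow_le_rpow_of_nonpos (by positivity) ?_ (by norm_num)
    exact le_mul_of_one_le_right (by positivity) hs1
  · rw [← ENNReal.ofReal_pow (by norm_num)]
    refine ENNReal.ofReal_le_ofReal ((min_le_left _ _).trans ?_)
    rw [zpow_neg, ← Nat.cast_add_one, zpow_natCast, pow_succ, one_div_pow]
    have : (0 : ℝ) < 2 ^ n := by positivity
    rw [inv_mul_le_iff₀ (by positivity)]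
    field_simp
    exact hs2.le

theorem aestronglyMeasurable_of_continuousOn_compl_zero [Nontrivial V] {m : V → ℂ}
    (hm : ContinuousOn m {0}ᶜ) : AEStronglyMeasurable m := by
  have h := hm.aestronglyMeasurable (μ := (volume : Measure V)) (measurableSet_singleton 0).compl
  rwa [Measure.restrict_eq_self_of_ae_mem] at h
  exact Measure.ae_ne volume 0

theorem exists_multiplier_atom_bound [Nontrivial V] {N : ℕ}
    (hN : Module.finrank ℝ V + 1 ≤ 2 * N) :
    ∃ C : ℝ≥0, ∀ (M : ℝ) (m : V → ℂ)
      (T : Lp (α := V) ℂ 2 volume →L[ℂ] Lp (α := V) ℂ 2 volume), 0 ≤ M → (∀ ξ, ‖m ξ‖ ≤ M) →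
      ContDiffOn ℝ N m {0}ᶜ →
      (∀ i ≤ N, ∀ ξ, ξ ≠ 0 → ‖ξ‖ ^ i * ‖iteratedFDerivWithin ℝ i m {0}ᶜ ξ‖ ≤ M) →
      IsL2Multiplier m T →
      ∀ (b : V → ℂ) (c : V) (r : ℝ), 0 < r → ∀ hb : MemLp b 2, (∀ y ∉ closedBall c r, b y = 0) →
      ∫ y, b y = 0 →
      ∫⁻ x in (closedBall c (2 * r))ᶜ, ‖T (hb.toLp b) x‖ₑ ≤
        C * ENNReal.ofReal M * ∫⁻ y, ‖b y‖ₑ := by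
  obtain ⟨φ, A, hφ, hφlow, hφ1, hφlim⟩ := exists_dyadic_cutoff (V := V) N
  obtain ⟨C₁, hC₁⟩ := exists_bandOperator_atom_bound (V := V) hN
  obtain ⟨C₂, hC₂⟩ := exists_tsum_dyadic_min_le
  have hA : 0 ≤ A := (hφ 1 one_pos).nonneg
  refine ⟨C₁ * (2 ^ N * 2 ^ N * A).toNNReal * C₂, fun M m T hM0 hM hm hmM hT b c r hr hb hbs hb0 => ?_⟩
  have hbi : Integrable b := by
    have : IsFiniteMeasure ((volume : Measure V).restrict (closedBall c r)) :=
      isFiniteMeasure_restrict.2 measure_closedBall_lt_top.ne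
    have : IntegrableOn b (closedBall c r) :=
      (hb.restrict _).integrable (by norm_num)
    exact (integrableOn_iff_integrable_of_support_subset
      fun y hy => by_contra fun h => hy (hbs y h)).1 this
  set n : ℤ → V → ℂ := fun j ξ => m ξ * φ (((2 : ℝ) ^ j)⁻¹ • ξ) with hn
  set A' := 2 ^ N * (2 ^ N * M) * A with hA'
  have h2 (j : ℤ) : (0 : ℝ) < 2 ^ j := by positivity
  have hband (j : ℤ) : BandBound N (2 ^ j) A' (n j) :=
    (hφ _ (h2 j)).mikhlin_mul (h2 j) (hφlow _ (h2 j)) hm hmM hM0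
  set σ : ℕ → V → ℂ := fun J ξ => ∑ j ∈ Finset.Icc (-J : ℤ) J, n j ξ with hσ
  have hσM (J : ℕ) (ξ : V) : ‖σ J ξ‖ ≤ M := by
    simp only [hσ, hn]
    rw [← Finset.mul_sum, norm_mul]
    exact (mul_le_of_le_one_right (norm_nonneg _) (hφ1 J ξ)).trans (hM ξ)
  have hσlim : ∀ᵐ ξ, Tendsto (fun J => σ J ξ) atTop (𝓝 (m ξ)) := by
    filter_upwards [Measure.ae_ne volume (0 : V)] with ξ hξ
    simp only [hσ, hn]
    simp_rw [← Finset.mul_sum]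
    simpa using (hφlim ξ hξ).const_mul (m ξ)
  have hσc (J : ℕ) : Continuous (σ J) :=
    continuous_finsetSum _ fun j _ => (hband j).contDiff.continuous
  choose S hS using fun J => exists_isL2Multiplier (hσc J).aestronglyMeasurable (hσM J)
  have hFb (ξ : V) : ‖𝓕 b ξ‖ ≤ ∫ y, ‖b y‖ :=
    VectorFourier.norm_fourierIntegral_le_integral_norm _ _ _ _ _
  have hni (j : ℤ) : Integrable fun ξ => n j ξ * 𝓕 b ξ :=
    (hband j).integrable.mul_bdd
      (continuous_fourier_of_integrable hbi).aestronglyMeasurable (.of_forall hFb)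
  have hσF (J : ℕ) : (fun ξ => σ J ξ * 𝓕 b ξ) =
      fun ξ => ∑ j ∈ Finset.Icc (-J : ℤ) J, n j ξ * 𝓕 b ξ := by
    funext ξ
    simp only [hσ, Finset.sum_mul]
  have hσi (J : ℕ) : Integrable fun ξ => σ J ξ * 𝓕 b ξ := by
    rw [hσF]
    exact integrable_finsetSum _ fun j _ => hni j
  refine lintegral_enorm_le_of_tendsto_Lp
    (hT.tendsto_apply hS hσM hM hσlim (hb.toLp b)) fun J => ?_
  have hSJ := (hS J).coeFn_apply_toLp (hσc J).aestronglyMeasurable (hσM J) hbi hb (hσi J)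
  have hsum (x : V) : 𝓕⁻ (fun ξ => σ J ξ * 𝓕 b ξ) x =
      ∑ j ∈ Finset.Icc (-J : ℤ) J, 𝓕⁻ (fun ξ => n j ξ * 𝓕 b ξ) x := by
    rw [hσF]
    simp only [fourierInv_apply_eq_integral, Finset.mul_sum]
    exact integral_finsetSum _ fun j _ => integrable_cexp_mul (hni j) x
  calc ∫⁻ x in (closedBall c (2 * r))ᶜ, ‖S J (hb.toLp b) x‖ₑ
      = ∫⁻ x in (closedBall c (2 * r))ᶜ, ‖𝓕⁻ (fun ξ => σ J ξ * 𝓕 b ξ) x‖ₑ := by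
        refine lintegral_congr_ae (ae_restrict_of_ae ?_)
        filter_upwards [hSJ] with x hx
        rw [hx]
    _ ≤ ∫⁻ x in (closedBall c (2 * r))ᶜ,
          ∑ j ∈ Finset.Icc (-J : ℤ) J, ‖𝓕⁻ (fun ξ => n j ξ * 𝓕 b ξ) x‖ₑ := by
        refine lintegral_mono fun x => ?_
        rw [hsum]
        exact enorm_sum_le _ _
    _ = ∑ j ∈ Finset.Icc (-J : ℤ) J,
          ∫⁻ x in (closedBall c (2 * r))ᶜ, ‖𝓕⁻ (fun ξ => n j ξ * 𝓕 b ξ) x‖ₑ :=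
        lintegral_finsetSum _ fun j _ =>
          (continuous_fourierInv_of_integrable (hni j)).enorm.measurable
    _ ≤ ∑ j ∈ Finset.Icc (-J : ℤ) J, C₁ * ENNReal.ofReal A' *
          ENNReal.ofReal (min ((2 : ℝ) ^ j * r) (((2 : ℝ) ^ j * r) ^ (-(1 / 4) : ℝ))) *
            ∫⁻ y, ‖b y‖ₑ :=
        Finset.sum_le_sum fun j _ => hC₁ _ _ _ (h2 j) (hband j) b c r hr hbi hbs hb0
    _ = C₁ * ENNReal.ofReal A' * (∑ j ∈ Finset.Icc (-J : ℤ) J,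
          ENNReal.ofReal (min ((2 : ℝ) ^ j * r) (((2 : ℝ) ^ j * r) ^ (-(1 / 4) : ℝ)))) *
            ∫⁻ y, ‖b y‖ₑ := by
        rw [Finset.mul_sum, Finset.sum_mul]
    _ ≤ C₁ * ENNReal.ofReal A' * C₂ * ∫⁻ y, ‖b y‖ₑ := by
        gcongr
        exact (ENNReal.sum_le_tsum _).trans (hC₂ r hr)
    _ = _ := by
        have : ENNReal.ofReal A' = (2 ^ N * 2 ^ N * A).toNNReal * ENNReal.ofReal M := by
          rw [ENNReal.ofNNReal_toNNReal, ← ENNReal.ofReal_mul (by positivity), hA']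
          congr 1
          ring
        rw [this]
        push_cast
        ring

theorem exists_pairwise_disjoint_between {ι α : Type*} [MeasurableSpace α] [Countable ι]
    {A B : ι → Set α} (hA : ∀ i, MeasurableSet (A i)) (hB : ∀ i, MeasurableSet (B i))
    (hAB : ∀ i, A i ⊆ B i) (hd : Pairwise (Function.onFun Disjoint A)) :
    ∃ Q : ι → Set α, (∀ i, MeasurableSet (Q i)) ∧ Pairwise (Function.onFun Disjoint Q) ∧
      (∀ i, A i ⊆ Q i) ∧ (∀ i, Q i ⊆ B i) ∧ ⋃ i, B i ⊆ ⋃ i, Q i := by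
  obtain ⟨e, he⟩ := exists_injective_nat ι
  refine ⟨fun i => A i ∪ (B i \ ((⋃ k, A k) ∪ ⋃ j, ⋃ _ : e j < e i, B j)), fun i => ?_, ?_,
    fun i => subset_union_left, fun i => union_subset (hAB i) sdiff_subset, ?_⟩
  · exact (hA i).union ((hB i).diff ((MeasurableSet.iUnion hA).union
      (MeasurableSet.iUnion fun j => MeasurableSet.iUnion fun _ => hB j)))
  · intro i j hij
    rw [Function.onFun, Set.disjoint_left]
    have hdij := Set.disjoint_left.1 (hd hij)
    intro x hxi hxj
    simp only [mem_union, Set.mem_sdiff, mem_iUnion, not_or, not_exists] at hxi hxj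
    rcases hxi with hx | ⟨hx, hx₁, hx₂⟩ <;> rcases hxj with hy | ⟨hy, hy₁, hy₂⟩
    · exact hdij hx hy
    · exact hy₁ i hx
    · exact hx₁ j hy
    · rcases lt_or_gt_of_ne (he.ne hij) with h | h
      · exact hy₂ i h hx
      · exact hx₂ j h hy
  · intro x hx
    by_cases hxA : ∃ k, x ∈ A k
    · obtain ⟨k, hk⟩ := hxA
      exact mem_iUnion.2 ⟨k, Or.inl hk⟩
    · have hne : {i | x ∈ B i}.Nonempty := mem_iUnion.1 hx
      obtain ⟨i, hi, hmin⟩ := exists_minimalFor_of_wellFoundedLT (fun i => x ∈ B i) e hne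
      refine mem_iUnion.2 ⟨i, Or.inr ⟨hi, ?_⟩⟩
      simp only [mem_union, mem_iUnion, not_or, not_exists]
      refine ⟨fun k hk => hxA ⟨k, hk⟩, fun j hj hxj => ?_⟩
      exact absurd (hmin hxj hj.le) (not_le.2 hj)

theorem mul_measure_le_two_mul_lintegral {α : Type*} [MeasurableSpace α] {μ : Measure α}
    {F : α → ℝ≥0∞} (hF : Measurable F) {t : ℝ≥0∞} (ht : t ≠ ⊤) {B : Set α}
    (hμ : μ B ≠ ⊤) (h : t * μ B ≤ ∫⁻ x in B, F x ∂μ) :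
    t * μ B ≤ 2 * ∫⁻ x in B ∩ {x | t / 2 < F x}, F x ∂μ := by
  have hS : MeasurableSet {x | t / 2 < F x} := measurableSet_lt measurable_const hF
  have h1 : ∫⁻ x in B, F x ∂μ ≤ t / 2 * μ B + ∫⁻ x in B ∩ {x | t / 2 < F x}, F x ∂μ := by
    rw [← lintegral_inter_add_sdiff F B hS, add_comm]
    gcongr
    calc ∫⁻ x in B \ {x | t / 2 < F x}, F x ∂μ
        ≤ ∫⁻ _ in B \ {x | t / 2 < F x}, t / 2 ∂μ :=
          setLIntegral_mono measurable_const fun x hx => not_lt.1 hx.2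
      _ ≤ t / 2 * μ B := by
          rw [setLIntegral_const]
          gcongr
          exact sdiff_subset
  have h2 : t / 2 * μ B + t / 2 * μ B ≤
      t / 2 * μ B + ∫⁻ x in B ∩ {x | t / 2 < F x}, F x ∂μ := by
    rw [← add_mul, ENNReal.add_halves]
    exact h.trans h1
  have h3 : t / 2 * μ B ≠ ⊤ := ENNReal.mul_ne_top (by finiteness) hμ
  calc t * μ B = 2 * (t / 2 * μ B) := by
        rw [← mul_assoc, ENNReal.mul_div_cancel two_ne_zero ENNReal.ofNat_ne_top]
    _ ≤ _ := by
        gcongr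
        exact (ENNReal.add_le_add_iff_left h3).1 h2

theorem exists_calderonZygmund_cover [Nontrivial V] {F : V → ℝ≥0∞} (hF : Measurable F)
    {t : ℝ≥0∞} (ht0 : t ≠ 0) (ht : t ≠ ⊤) (hG : ∫⁻ x in {x | t / 2 < F x}, F x ≠ ⊤) :
    ∃ (u : Set V) (r : u → ℝ) (Q : u → Set V), Countable u ∧ (∀ i, 0 < r i) ∧
      (∀ i, MeasurableSet (Q i)) ∧ Pairwise (Function.onFun Disjoint Q) ∧
      (∀ i : u, Q i ⊆ closedBall (i : V) (5 * r i)) ∧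
      (∀ i : u, ∫⁻ x in Q i, F x ≤ t * volume (closedBall (i : V) (5 * r i))) ∧
      (∀ i : u, closedBall (i : V) (r i) ⊆ Q i) ∧
      (∀ᵐ x, (∀ i, x ∉ Q i) → F x ≤ t) ∧
      t * ∑' i : u, volume (closedBall (i : V) (r i)) ≤ 2 * ∫⁻ x in {x | t / 2 < F x}, F x := by
  have hS : MeasurableSet {x | t / 2 < F x} := measurableSet_lt measurable_const hF
  set G := ∫⁻ x in {x | t / 2 < F x}, F x with hGdef
  let good : V → Set ℝ := fun x =>
    {r | 0 < r ∧ t * volume (closedBall x r) < ∫⁻ y in closedBall x r, F y}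
  have hgood (x : V) (r : ℝ) (hr : r ∈ good x) : t * volume (closedBall x r) ≤
      2 * ∫⁻ y in closedBall x r ∩ {x | t / 2 < F x}, F y :=
    mul_measure_le_two_mul_lintegral hF ht measure_closedBall_lt_top.ne hr.2.le
  set K := 2 * G / (t * volume (closedBall (0 : V) 1)) with hK
  have hv0 : volume (closedBall (0 : V) 1) ≠ 0 := (measure_closedBall_pos _ _ one_pos).ne'
  have hvt : volume (closedBall (0 : V) 1) ≠ ⊤ := measure_closedBall_lt_top.ne
  have hKt : K ≠ ⊤ := ENNReal.div_ne_top (by finiteness) (mul_ne_zero ht0 hv0)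
  have hbound (x : V) (r : ℝ) (hr : r ∈ good x) : r ≤ 1 + K.toReal := by
    rcases le_total r 1 with h | h
    · exact h.trans (le_add_of_nonneg_right ENNReal.toReal_nonneg)
    · have h1 : ENNReal.ofReal (r ^ Module.finrank ℝ V) ≤ K := by
        rw [hK, ENNReal.le_div_iff_mul_le (.inl (mul_ne_zero ht0 hv0))
          (.inl (ENNReal.mul_ne_top ht hvt))]
        calc ENNReal.ofReal (r ^ Module.finrank ℝ V) * (t * volume (closedBall (0 : V) 1))
            = t * volume (closedBall x r) := by
              rw [Measure.addHaar_closedBall' _ x hr.1.le]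
              ring
          _ ≤ _ := (hgood x r hr).trans (by
              gcongr
              exact lintegral_mono_set inter_subset_right)
      have h2 : r ^ Module.finrank ℝ V ≤ K.toReal := (ENNReal.ofReal_le_iff_le_toReal hKt).1 h1
      have h3 : r ≤ r ^ Module.finrank ℝ V :=
        le_self_pow₀ h (Module.finrank_pos (R := ℝ) (M := V)).ne'
      linarith
  have hbdd (x : V) : BddAbove (good x) := ⟨_, fun r hr => hbound x r hr⟩
  let E : Set V := {x | (good x).Nonempty}
  have hex (x : V) : ∃ r, x ∈ E → r ∈ good x ∧ sSup (good x) / 2 < r := by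
    by_cases hx : x ∈ E
    · obtain ⟨s, hs⟩ := id hx
      have : sSup (good x) / 2 < sSup (good x) := half_lt_self (hs.1.trans_le (le_csSup (hbdd x) hs))
      obtain ⟨r, hr, hr'⟩ := exists_lt_of_lt_csSup hx this
      exact ⟨r, fun _ => ⟨hr, hr'⟩⟩
    · exact ⟨0, fun h => absurd h hx⟩
  choose ρ hρ using hex
  obtain ⟨u, huE, hud, huc⟩ := Vitali.exists_disjoint_subfamily_covering_enlargement_closedBall
    E (fun x => x) ρ (1 + K.toReal) (fun x hx => hbound x _ (hρ x hx).1) 5 (by norm_num)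
  have hpos (i : u) : 0 < ρ i := (hρ i (huE i.2)).1.1
  have hcount : Countable u := by
    refine (hud.countable_of_nonempty_interior fun i hi => ?_).to_subtype
    refine ⟨i, ?_⟩
    exact ball_subset_interior_closedBall (mem_ball_self (hpos ⟨i, hi⟩))
  have hd : Pairwise (Function.onFun Disjoint fun i : u => closedBall (i : V) (ρ i)) :=
    fun i j hij => hud i.2 j.2 fun h => hij (Subtype.ext h)
  obtain ⟨Q, hQm, hQd, hQ1, hQ2, hQ3⟩ := exists_pairwise_disjoint_between
    (A := fun i : u => closedBall (i : V) (ρ i)) (B := fun i : u => closedBall (i : V) (5 * ρ i))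
    (fun _ => measurableSet_closedBall) (fun _ => measurableSet_closedBall)
    (fun i => closedBall_subset_closedBall (by linarith [hpos i])) hd
  refine ⟨u, fun i => ρ i, Q, hcount, hpos, hQm, hQd, hQ2, fun i => ?_, hQ1, ?_, ?_⟩
  · refine (lintegral_mono_set (hQ2 i)).trans ?_
    by_contra! h
    have h5 : 5 * ρ i ∈ good i := ⟨by linarith [hpos i], h⟩
    have := le_csSup (hbdd i) h5
    linarith [(hρ i (huE i.2)).2, hpos i]
  · have hFi : ∫⁻ x, {x | t / 2 < F x}.indicator F x ≠ ⊤ := by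
      rwa [lintegral_indicator hS]
    filter_upwards [(Besicovitch.vitaliFamily (volume : Measure V)).ae_tendsto_lintegral_div
      (hF.indicator hS).aemeasurable hFi] with x hx hxQ
    by_contra! hxt
    have hxS : x ∈ {x | t / 2 < F x} := ENNReal.half_le_self.trans_lt hxt
    rw [indicator_of_mem hxS] at hx
    have h1 := (hx.comp (Besicovitch.tendsto_filterAt volume x)).eventually_const_lt hxt
    obtain ⟨r, hr, hr0⟩ := (h1.and self_mem_nhdsWithin).exists
    have hr0 : 0 < r := hr0
    have hxE : x ∈ E := by
      refine ⟨r, hr0, ?_⟩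
      have h2 : t * volume (closedBall x r) <
          ∫⁻ y in closedBall x r, {x | t / 2 < F x}.indicator F y :=
        (ENNReal.lt_div_iff_mul_lt (.inl (measure_closedBall_pos _ _ hr0).ne')
          (.inl measure_closedBall_lt_top.ne)).1 hr
      exact h2.trans_le (lintegral_mono fun y => indicator_le_self _ _ y)
    obtain ⟨b, hb, hxb⟩ := huc x hxE
    have := hQ3 (mem_iUnion.2 ⟨⟨b, hb⟩, hxb (mem_closedBall_self (hρ x hxE).1.1.le)⟩)
    obtain ⟨i, hi⟩ := mem_iUnion.1 this
    exact hxQ i hi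
  · rw [← ENNReal.tsum_mul_left]
    calc ∑' i : u, t * volume (closedBall (i : V) (ρ i))
        ≤ ∑' i : u, 2 * ∫⁻ y in closedBall (i : V) (ρ i) ∩ {x | t / 2 < F x}, F y :=
          ENNReal.tsum_le_tsum fun i => hgood _ _ (hρ i (huE i.2)).1
      _ = 2 * ∫⁻ y in ⋃ i : u, closedBall (i : V) (ρ i) ∩ {x | t / 2 < F x}, F y := by
          rw [ENNReal.tsum_mul_left, lintegral_iUnion
            (fun i => measurableSet_closedBall.inter hS)
            fun i j hij => (hd hij).mono inter_subset_left inter_subset_left]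
      _ ≤ 2 * G := by
          gcongr
          exact lintegral_mono_set (iUnion_subset fun i => inter_subset_right)

theorem volume_closedBall_mul (c : V) {s r : ℝ} (hs : 0 ≤ s) (hr : 0 ≤ r) :
    volume (closedBall c (s * r)) =
      ENNReal.ofReal (s ^ Module.finrank ℝ V) * volume (closedBall c r) := by
  rw [Measure.addHaar_closedBall' _ c hr, Measure.addHaar_closedBall' _ c (mul_nonneg hs hr),
    mul_pow, ENNReal.ofReal_mul (by positivity), mul_assoc]

theorem setLIntegral_enorm_ne_top {α : Type*} [MeasurableSpace α] {μ : Measure α} {f : α → ℂ}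
    (hf : Measurable f) (hf2 : MemLp f 2 μ) {t : ℝ≥0∞} (ht0 : t ≠ 0) :
    ∫⁻ x in {x | t / 2 < ‖f x‖ₑ}, ‖f x‖ₑ ∂μ ≠ ⊤ := by
  have h1 : t / 2 * ∫⁻ x in {x | t / 2 < ‖f x‖ₑ}, ‖f x‖ₑ ∂μ ≤ ∫⁻ x, ‖f x‖ₑ ^ 2 ∂μ := by
    rw [← lintegral_const_mul _ hf.enorm]
    refine (setLIntegral_mono (hf.enorm.pow_const 2) fun x hx => ?_).trans
      (setLIntegral_le_lintegral _ _)
    rw [pow_two]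
    exact mul_le_mul_left hx.le _
  have h2 : ∫⁻ x, ‖f x‖ₑ ^ 2 ∂μ ≠ ⊤ := by
    rw [lintegral_enorm_sq_eq]
    exact ENNReal.pow_ne_top hf2.2.ne
  exact (ENNReal.lt_top_of_mul_ne_top_right (ne_top_of_le_ne_top h2 h1)
    (ENNReal.div_pos ht0 ENNReal.ofNat_ne_top).ne').ne

theorem exists_calderonZygmund_decomposition [Nontrivial V] : ∃ K : ℝ≥0, ∀ f : V → ℂ,
    Measurable f → MemLp f 2 → ∀ t : ℝ≥0∞, t ≠ 0 → t ≠ ⊤ →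
    ∃ (u : Set V) (r : u → ℝ) (b : u → V → ℂ) (g : V → ℂ), Countable u ∧ (∀ i, 0 < r i) ∧
      (∀ i, MemLp (b i) 2) ∧ (∀ i : u, ∀ y ∉ closedBall (i : V) (r i), b i y = 0) ∧
      (∀ i, ∫ y, b i y = 0) ∧ MemLp g 2 ∧
      (∀ x, (f x = g x ∧ ∀ i, b i x = 0) ∨ ∃ i, f x = g x + b i x ∧ ∀ j, j ≠ i → b j x = 0) ∧
      ∫⁻ x, ‖g x‖ₑ ^ 2 ≤ (∫⁻ x in {x | ‖f x‖ₑ ≤ t}, ‖f x‖ₑ ^ 2) +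
        K * (t * ∫⁻ x in {x | t / 2 < ‖f x‖ₑ}, ‖f x‖ₑ) ∧
      t * ∑' i : u, volume (closedBall (i : V) (2 * r i)) ≤
        K * ∫⁻ x in {x | t / 2 < ‖f x‖ₑ}, ‖f x‖ₑ ∧
      ∑' i, ∫⁻ y, ‖b i y‖ₑ ≤ K * ∫⁻ x in {x | t / 2 < ‖f x‖ₑ}, ‖f x‖ₑ := by
  set k : ℝ≥0 := ((5 : ℝ) ^ Module.finrank ℝ V).toNNReal with hk
  set k' : ℝ≥0 := ((10 : ℝ) ^ Module.finrank ℝ V).toNNReal with hk'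
  refine ⟨2 * k ^ 3 + 2 * k' + 4 * k, fun f hf hf2 t ht0 ht => ?_⟩
  have hGt := setLIntegral_enorm_ne_top hf hf2 ht0
  obtain ⟨u, r, Q, hu, hr, hQm, hQd, hQ5, hQF, hQB, hae, hsum⟩ :=
    exists_calderonZygmund_cover hf.enorm ht0 ht hGt
  set G := ∫⁻ x in {x | t / 2 < ‖f x‖ₑ}, ‖f x‖ₑ with hG
  have hv5 (i : u) : volume (closedBall (i : V) (5 * r i)) = k * volume (closedBall (i : V) (r i)) :=
    volume_closedBall_mul _ (by norm_num) (hr i).le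
  have hv10 (i : u) : volume (closedBall (i : V) (2 * (5 * r i))) =
      k' * volume (closedBall (i : V) (r i)) := by
    rw [← mul_assoc, show (2 * 5 : ℝ) = 10 by norm_num]
    exact volume_closedBall_mul _ (by norm_num) (hr i).le
  have hQt (i : u) : volume (Q i) ≠ ⊤ :=
    ne_top_of_le_ne_top measure_closedBall_lt_top.ne (measure_mono (hQ5 i))
  have hQ0 (i : u) : volume (Q i) ≠ 0 :=
    ((measure_closedBall_pos _ _ (hr i)).trans_le (measure_mono (hQB i))).ne'
  have hfin (i : u) : IsFiniteMeasure (volume.restrict (Q i)) :=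
    isFiniteMeasure_restrict.2 (hQt i)
  have hfi (i : u) : IntegrableOn f (Q i) := (hf2.restrict (Q i)).integrable one_le_two
  set a : u → ℂ := fun i => ⨍ x in Q i, f x with ha
  have haQ (i : u) : ‖a i‖ₑ * volume (Q i) ≤ ∫⁻ x in Q i, ‖f x‖ₑ := by
    have h1 : volume.real (Q i) • a i = ∫ x in Q i, f x := measure_smul_setAverage f (hQt i)
    have h2 : ‖volume.real (Q i) • a i‖ₑ = ‖a i‖ₑ * volume (Q i) := by
      rw [enorm_smul, mul_comm, Real.enorm_of_nonneg measureReal_nonneg, ofReal_measureReal (hQt i)]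
    rw [← h2, h1]
    exact enorm_integral_le_lintegral_enorm _
  have hFQ (i : u) : ∫⁻ x in Q i, ‖f x‖ₑ ≤ t * k * volume (closedBall (i : V) (r i)) := by
    rw [mul_assoc, ← hv5]
    exact hQF i
  have hat (i : u) : ‖a i‖ₑ ≤ t * k := by
    refine (ENNReal.mul_le_mul_iff_left (hQ0 i) (hQt i)).1 ((haQ i).trans ((hFQ i).trans ?_))
    gcongr
    exact hQB i
  set b : u → V → ℂ := fun i => (Q i).indicator fun x => f x - a i with hb
  have hbm (i : u) : MemLp (b i) 2 :=
    (memLp_indicator_iff_restrict (hQm i)).2 ((hf2.restrict (Q i)).sub (memLp_const (a i)))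
  obtain ⟨g, hgm, hg⟩ := exists_measurable_piecewise
    (fun o : Option u => o.elim (⋃ i, Q i)ᶜ Q)
    (by rintro (_ | i); exacts [(MeasurableSet.iUnion hQm).compl, hQm i])
    (fun o : Option u => o.elim f fun i _ => a i)
    (by rintro (_ | i); exacts [hf, measurable_const])
    (by
      rintro (_ | i) (_ | j) hij x ⟨hx, hy⟩
      · exact absurd rfl hij
      · exact absurd (mem_iUnion.2 ⟨j, hy⟩) hx
      · exact absurd (mem_iUnion.2 ⟨i, hx⟩) hy
      · exact absurd hy (Set.disjoint_left.1 (hQd fun h => hij (congrArg some h)) hx))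
  have hg0 (x : V) (hx : x ∉ ⋃ i, Q i) : g x = f x := hg none hx
  have hgQ (i : u) (x : V) (hx : x ∈ Q i) : g x = a i := hg (some i) hx
  have hQk (i : u) : volume (Q i) ≤ k * volume (closedBall (i : V) (r i)) :=
    (measure_mono (hQ5 i)).trans (hv5 i).le
  have hg2 : ∫⁻ x, ‖g x‖ₑ ^ 2 ≤
      (∫⁻ x in {x | ‖f x‖ₑ ≤ t}, ‖f x‖ₑ ^ 2) + (2 * k ^ 3 : ℝ≥0) * (t * G) := by
    rw [← lintegral_add_compl _ (MeasurableSet.iUnion hQm), add_comm]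
    refine add_le_add ?_ ?_
    · calc ∫⁻ x in (⋃ i, Q i)ᶜ, ‖g x‖ₑ ^ 2 = ∫⁻ x in (⋃ i, Q i)ᶜ, ‖f x‖ₑ ^ 2 :=
            setLIntegral_congr_fun (MeasurableSet.iUnion hQm).compl fun x hx => by
              simp only [hg0 x hx]
        _ ≤ _ := by
            refine lintegral_mono_set' ?_
            filter_upwards [hae] with x hx hxQ
            exact hx fun i hi => hxQ (mem_iUnion.2 ⟨i, hi⟩)
    · rw [lintegral_iUnion hQm hQd]
      calc ∑' i, ∫⁻ x in Q i, ‖g x‖ₑ ^ 2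
          ≤ ∑' i : u, t ^ 2 * k ^ 3 * volume (closedBall (i : V) (r i)) := by
            refine ENNReal.tsum_le_tsum fun i => ?_
            have h1 : ∫⁻ x in Q i, ‖g x‖ₑ ^ 2 = ∫⁻ _ in Q i, ‖a i‖ₑ ^ 2 :=
              setLIntegral_congr_fun (hQm i) fun x hx => by simp only [hgQ i x hx]
            rw [h1, setLIntegral_const]
            calc ‖a i‖ₑ ^ 2 * volume (Q i)
                ≤ (t * k) ^ 2 * (k * volume (closedBall (i : V) (r i))) := by
                  gcongr
                  exacts [hat i, hQk i]
              _ = _ := by ring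
        _ = t * k ^ 3 * (t * ∑' i : u, volume (closedBall (i : V) (r i))) := by
            rw [ENNReal.tsum_mul_left]
            ring
        _ ≤ t * k ^ 3 * (2 * G) := by gcongr
        _ = _ := by
            push_cast
            ring
  have hf2t : ∫⁻ x, ‖f x‖ₑ ^ 2 ≠ ⊤ := by
    rw [lintegral_enorm_sq_eq]
    exact ENNReal.pow_ne_top hf2.2.ne
  have hgm2 : MemLp g 2 := by
    refine ⟨hgm.aestronglyMeasurable, ?_⟩
    have h1 : ∫⁻ x, ‖g x‖ₑ ^ 2 ≠ ⊤ := by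
      refine ne_top_of_le_ne_top (ENNReal.add_ne_top.2 ⟨?_, ?_⟩) hg2
      · exact ne_top_of_le_ne_top hf2t (setLIntegral_le_lintegral _ _)
      · finiteness
    rw [lintegral_enorm_sq_eq] at h1
    rw [lt_top_iff_ne_top]
    intro h
    simp [h] at h1
  refine ⟨u, fun i => 5 * r i, b, g, hu, fun i => by linarith [hr i], hbm, fun i y hy => ?_,
    fun i => ?_, hgm2, fun x => ?_, hg2.trans ?_, ?_, ?_⟩
  · exact indicator_of_notMem (fun h => hy (hQ5 i h)) _
  · rw [hb, integral_indicator (hQm i), integral_sub (hfi i) (integrable_const _),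
      setIntegral_const, sub_eq_zero]
    exact (measure_smul_setAverage f (hQt i)).symm
  · by_cases hx : x ∈ ⋃ i, Q i
    · obtain ⟨i, hi⟩ := mem_iUnion.1 hx
      refine Or.inr ⟨i, ?_, fun j hj => ?_⟩
      · rw [hgQ i x hi, hb]
        simp [indicator_of_mem hi]
      · exact indicator_of_notMem (Set.disjoint_left.1 (hQd hj.symm) hi) _
    · refine Or.inl ⟨(hg0 x hx).symm, fun i => ?_⟩
      exact indicator_of_notMem (fun h => hx (mem_iUnion.2 ⟨i, h⟩)) _
  · gcongr
    rw [add_assoc]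
    exact le_self_add
  · calc t * ∑' i : u, volume (closedBall (i : V) (2 * (5 * r i)))
        = k' * (t * ∑' i : u, volume (closedBall (i : V) (r i))) := by
          simp_rw [hv10, ENNReal.tsum_mul_left]
          ring
      _ ≤ k' * (2 * G) := by gcongr
      _ = (2 * k' : ℝ≥0) * G := by
          push_cast
          ring
      _ ≤ _ := by
          gcongr
          exact le_add_right le_add_self
  · calc ∑' i, ∫⁻ y, ‖b i y‖ₑ
        ≤ ∑' i : u, 2 * (t * k) * volume (closedBall (i : V) (r i)) := by
          refine ENNReal.tsum_le_tsum fun i => ?_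
          have h1 (y : V) : ‖b i y‖ₑ = (Q i).indicator (fun x => ‖f x - a i‖ₑ) y := by
            rw [hb, enorm_indicator_eq_indicator_enorm]
          simp_rw [h1]
          rw [lintegral_indicator (hQm i)]
          calc ∫⁻ x in Q i, ‖f x - a i‖ₑ ≤ ∫⁻ x in Q i, (‖f x‖ₑ + ‖a i‖ₑ) :=
                lintegral_mono fun x => enorm_sub_le
            _ = (∫⁻ x in Q i, ‖f x‖ₑ) + ‖a i‖ₑ * volume (Q i) := by
                rw [lintegral_add_right _ measurable_const, setLIntegral_const]
            _ ≤ t * k * volume (closedBall (i : V) (r i)) +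
                  t * k * volume (closedBall (i : V) (r i)) :=
                add_le_add (hFQ i) ((haQ i).trans (hFQ i))
            _ = _ := by ring
      _ = 2 * k * (t * ∑' i : u, volume (closedBall (i : V) (r i))) := by
          rw [ENNReal.tsum_mul_left]
          ring
      _ ≤ 2 * k * (2 * G) := by gcongr
      _ = (4 * k : ℝ≥0) * G := by
          push_cast
          ring
      _ ≤ _ := by
          gcongr
          exact le_add_self

theorem exists_tendsto_sum_toLp {ι : Type*} [Countable ι] {f g : V → ℂ} {b : ι → V → ℂ}
    (hf : MemLp f 2) (hg : MemLp g 2) (hb : ∀ i, MemLp (b i) 2)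
    (h : ∀ x, (f x = g x ∧ ∀ i, b i x = 0) ∨ ∃ i, f x = g x + b i x ∧ ∀ j, j ≠ i → b j x = 0) :
    ∃ s : ℕ → Finset ι, Tendsto (fun n => ∑ i ∈ s n, (hb i).toLp (b i)) atTop
      (𝓝 ((hf.sub hg).toLp (f - g))) := by
  obtain ⟨s, hs⟩ := exists_seq_tendsto (atTop : Filter (Finset ι))
  refine ⟨s, ?_⟩
  have hsm (n : ℕ) : MemLp (fun x => ∑ i ∈ s n, b i x) 2 := memLp_finsetSum _ fun i _ => hb i
  have hsum (n : ℕ) : ∑ i ∈ s n, (hb i).toLp (b i) = (hsm n).toLp _ := by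
    refine Lp.ext ?_
    have hall : ∀ᵐ x, ∀ i ∈ s n, (hb i).toLp (b i) x = b i x :=
      (Finset.eventually_all _).2 fun i _ => (hb i).coeFn_toLp
    filter_upwards [Lp.coeFn_fun_finsetSum (s n) fun i => (hb i).toLp (b i),
      (hsm n).coeFn_toLp, hall] with x h1 h2 h3
    rw [h1, h2]
    exact Finset.sum_congr rfl h3
  simp_rw [hsum]
  rw [Lp.tendsto_Lp_iff_tendsto_eLpNorm'']
  have hpt (x : V) : (∀ n, ‖(∑ i ∈ s n, b i x) - (f - g) x‖ₑ ≤ ‖(f - g) x‖ₑ) ∧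
      ∀ᶠ n in atTop, (∑ i ∈ s n, b i x) - (f - g) x = 0 := by
    rcases h x with ⟨h1, h2⟩ | ⟨i, h1, h2⟩
    · simp [h1, h2]
    · have h3 : (f - g) x = b i x := by simp [h1]
      rw [h3]
      refine ⟨fun n => ?_, ?_⟩
      · by_cases hi : i ∈ s n
        · rw [Finset.sum_eq_single_of_mem i hi fun j _ hj => h2 j hj]
          simp
        · rw [Finset.sum_eq_zero fun j hj => h2 j fun e => hi (e ▸ hj)]
          simp
      · filter_upwards [hs.eventually (eventually_ge_atTop {i})] with n hn
        rw [Finset.sum_eq_single_of_mem i (hn (Finset.mem_singleton_self i)) fun j _ hj => h2 j hj]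
        simp
  have h2 : Tendsto (fun n => ∫⁻ x, ‖(∑ i ∈ s n, b i x) - (f - g) x‖ₑ ^ 2) atTop (𝓝 0) := by
    have h0 : (0 : ℝ≥0∞) = ∫⁻ _ : V, 0 := by simp
    rw [h0]
    refine tendsto_lintegral_of_dominated_convergence' (fun x => ‖(f - g) x‖ₑ ^ 2)
      (fun n => ((hsm n).1.sub (hf.sub hg).1).enorm.pow_const 2)
      (fun n => .of_forall fun x => ?_) ?_ (.of_forall fun x => ?_)
    · have := (hpt x).1 n
      beta_reduce
      gcongr
    · rw [lintegral_enorm_sq_eq]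
      exact ENNReal.pow_ne_top (hf.sub hg).2.ne
    · refine tendsto_const_nhds.congr' ?_
      filter_upwards [(hpt x).2] with n hn
      rw [hn]
      simp
  have h3 := (ENNReal.continuous_rpow_const (y := (1 / 2 : ℝ))).tendsto _ |>.comp h2
  have h4 (n : ℕ) : eLpNorm ((fun x => ∑ i ∈ s n, b i x) - (f - g)) 2 volume =
      (∫⁻ x, ‖(∑ i ∈ s n, b i x) - (f - g) x‖ₑ ^ 2) ^ (1 / 2 : ℝ) := by
    rw [eLpNorm_eq_lintegral_rpow_enorm_toReal two_ne_zero ENNReal.ofNat_ne_top]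
    simp
  simp_rw [h4]
  simpa [Function.comp_def] using h3

theorem lintegral_enorm_sq_apply_le {M : ℝ≥0}
    {T : Lp (α := V) ℂ 2 volume →L[ℂ] Lp (α := V) ℂ 2 volume}
    (hT : ∀ u, ‖T u‖ ≤ M * ‖u‖) (u : Lp (α := V) ℂ 2 volume) :
    ∫⁻ x, ‖T u x‖ₑ ^ 2 ≤ M ^ 2 * ∫⁻ x, ‖u x‖ₑ ^ 2 := by
  rw [lintegral_enorm_sq_eq, lintegral_enorm_sq_eq, ← Lp.enorm_def, ← Lp.enorm_def, ← mul_pow]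
  gcongr
  rw [← ofReal_norm, ← ofReal_norm, ← ENNReal.ofReal_coe_nnreal,
    ← ENNReal.ofReal_mul M.coe_nonneg]
  exact ENNReal.ofReal_le_ofReal (hT u)

theorem exists_weakType_bound [Nontrivial V] (M A : ℝ≥0) : ∃ C : ℝ≥0,
    ∀ T : Lp (α := V) ℂ 2 volume →L[ℂ] Lp (α := V) ℂ 2 volume, (∀ u, ‖T u‖ ≤ M * ‖u‖) →
    (∀ (b : V → ℂ) (c : V) (r : ℝ), 0 < r → ∀ hb : MemLp b 2, (∀ y ∉ closedBall c r, b y = 0) →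
      ∫ y, b y = 0 →
      ∫⁻ x in (closedBall c (2 * r))ᶜ, ‖T (hb.toLp b) x‖ₑ ≤ A * ∫⁻ y, ‖b y‖ₑ) →
    ∀ (f : Lp (α := V) ℂ 2 volume) (t : ℝ≥0∞), t ≠ 0 → t ≠ ⊤ →
      t ^ 2 * volume {x | t < ‖T f x‖ₑ} ≤ C * ((∫⁻ x in {x | ‖f x‖ₑ ≤ t}, ‖f x‖ₑ ^ 2) +
        t * ∫⁻ x in {x | t / 2 < ‖f x‖ₑ}, ‖f x‖ₑ) := by
  obtain ⟨K, hK⟩ := exists_calderonZygmund_decomposition (V := V)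
  refine ⟨4 * M ^ 2 * (1 + K) + K + 2 * A * K, fun T hTM hTA f t ht0 ht => ?_⟩
  obtain ⟨u, r, b, g, hu, hr, hb, hbs, hb0, hg, hfgb, hg2, hv, hb1⟩ :=
    hK f (Lp.stronglyMeasurable f).measurable (Lp.memLp f) t ht0 ht
  set S := ∫⁻ x in {x | ‖f x‖ₑ ≤ t}, ‖f x‖ₑ ^ 2
  set G := ∫⁻ x in {x | t / 2 < ‖f x‖ₑ}, ‖f x‖ₑ
  obtain ⟨s, hs⟩ := exists_tendsto_sum_toLp (Lp.memLp f) hg hb hfgb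
  set β := ((Lp.memLp f).sub hg).toLp (⇑f - g)
  set γ := hg.toLp g
  have hfβ : f = γ + β := by
    have h1 : β = (Lp.memLp f).toLp f - γ := MemLp.toLp_sub _ _
    rw [h1, Lp.toLp_coeFn, add_sub_cancel]
  set Ω := ⋃ i : u, closedBall (i : V) (2 * r i)
  have hTβ : ∫⁻ x in Ωᶜ, ‖T β x‖ₑ ≤ A * (K * G) := by
    refine lintegral_enorm_le_of_tendsto_Lp ((T.continuous.tendsto _).comp hs) fun n => ?_
    have h1 : T (∑ i ∈ s n, (hb i).toLp (b i)) = ∑ i ∈ s n, T ((hb i).toLp (b i)) := map_sum _ _ _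
    calc ∫⁻ x in Ωᶜ, ‖T (∑ i ∈ s n, (hb i).toLp (b i)) x‖ₑ
        ≤ ∫⁻ x in Ωᶜ, ∑ i ∈ s n, ‖T ((hb i).toLp (b i)) x‖ₑ := by
          refine lintegral_mono_ae (ae_restrict_of_ae ?_)
          rw [h1]
          filter_upwards [Lp.coeFn_fun_finsetSum (s n) fun i => T ((hb i).toLp (b i))] with x hx
          rw [hx]
          exact enorm_sum_le _ _
      _ = ∑ i ∈ s n, ∫⁻ x in Ωᶜ, ‖T ((hb i).toLp (b i)) x‖ₑ :=
          lintegral_finsetSum _ fun i _ => (Lp.stronglyMeasurable _).measurable.enorm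
      _ ≤ ∑ i ∈ s n, A * ∫⁻ y, ‖b i y‖ₑ := by
          refine Finset.sum_le_sum fun i _ => ?_
          refine le_trans (lintegral_mono_set (compl_subset_compl.2 ?_))
            (hTA (b i) i (r i) (hr i) (hb i) (hbs i) (hb0 i))
          exact subset_iUnion (fun i : u => closedBall (i : V) (2 * r i)) i
      _ ≤ A * (K * G) := by
          rw [← Finset.mul_sum]
          gcongr
          exact (ENNReal.sum_le_tsum _).trans hb1
  have hTγ : ∫⁻ x, ‖T γ x‖ₑ ^ 2 ≤ M ^ 2 * (S + K * (t * G)) := by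
    refine (lintegral_enorm_sq_apply_le hTM γ).trans ?_
    gcongr
    refine le_of_eq_of_le (lintegral_congr_ae ?_) hg2
    filter_upwards [hg.coeFn_toLp] with x hx
    rw [hx]
  have hcov : volume {x | t < ‖T f x‖ₑ} ≤ volume {x | (t / 2) ^ 2 ≤ ‖T γ x‖ₑ ^ 2} +
      (volume Ω + volume ({x | t / 2 ≤ ‖T β x‖ₑ} ∩ Ωᶜ)) := by
    refine (measure_mono_ae ?_).trans ((measure_union_le _ _).trans
      (add_le_add_right (measure_union_le _ _) _))
    rw [hfβ, map_add]
    filter_upwards [Lp.coeFn_add (T γ) (T β)] with x hx hxt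
    have hxt : t < ‖(T γ + T β : Lp (α := V) ℂ 2 volume) x‖ₑ := hxt
    rw [hx] at hxt
    by_cases h1 : t / 2 ≤ ‖T γ x‖ₑ
    · exact Or.inl (pow_le_pow_left₀ zero_le h1 2)
    by_cases h2 : x ∈ Ω
    · exact Or.inr (Or.inl h2)
    refine Or.inr (Or.inr ⟨?_, h2⟩)
    by_contra h3
    refine hxt.not_ge ((enorm_add_le _ _).trans ?_)
    rw [← ENNReal.add_halves t]
    exact add_le_add (not_le.1 h1).le (not_le.1 h3).le
  have ht4 : t ^ 2 = 4 * (t / 2) ^ 2 := by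
    calc t ^ 2 = (2 * (t / 2)) ^ 2 := by
          rw [ENNReal.mul_div_cancel two_ne_zero ENNReal.ofNat_ne_top]
      _ = _ := by
          rw [mul_pow]
          norm_num
  have e1 : t ^ 2 * volume {x | (t / 2) ^ 2 ≤ ‖T γ x‖ₑ ^ 2} ≤
      4 * (M ^ 2 * (S + K * (t * G))) := by
    rw [ht4, mul_assoc]
    refine mul_le_mul_right ?_ _
    exact (mul_meas_ge_le_lintegral₀ ((Lp.aestronglyMeasurable _).enorm.pow_const 2) _).trans hTγ
  have e2 : t ^ 2 * volume Ω ≤ t * (K * G) := by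
    rw [pow_two, mul_assoc]
    refine mul_le_mul_right (le_trans ?_ hv) _
    gcongr
    exact measure_iUnion_le _
  have e3 : t ^ 2 * volume ({x | t / 2 ≤ ‖T β x‖ₑ} ∩ Ωᶜ) ≤ 2 * t * (A * (K * G)) := by
    have hΩ : MeasurableSet Ωᶜ := (MeasurableSet.iUnion fun _ => measurableSet_closedBall).compl
    have h1 : t / 2 * volume ({x | t / 2 ≤ ‖T β x‖ₑ} ∩ Ωᶜ) ≤ A * (K * G) := by
      rw [← Measure.restrict_apply' hΩ]
      exact (mul_meas_ge_le_lintegral₀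
        (Lp.aestronglyMeasurable _).enorm.restrict _).trans hTβ
    calc t ^ 2 * volume ({x | t / 2 ≤ ‖T β x‖ₑ} ∩ Ωᶜ)
        = 2 * t * (t / 2 * volume ({x | t / 2 ≤ ‖T β x‖ₑ} ∩ Ωᶜ)) := by
          have : t = 2 * (t / 2) := (ENNReal.mul_div_cancel two_ne_zero ENNReal.ofNat_ne_top).symm
          calc _ = t * t * volume ({x | t / 2 ≤ ‖T β x‖ₑ} ∩ Ωᶜ) := by rw [pow_two]
            _ = t * (2 * (t / 2)) * volume ({x | t / 2 ≤ ‖T β x‖ₑ} ∩ Ωᶜ) := by rw [← this]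
            _ = _ := by ring
      _ ≤ _ := by gcongr
  calc t ^ 2 * volume {x | t < ‖T f x‖ₑ}
      ≤ 4 * (M ^ 2 * (S + K * (t * G))) + (t * (K * G) + 2 * t * (A * (K * G))) := by
        refine (mul_le_mul_right hcov _).trans ?_
        rw [mul_add, mul_add]
        exact add_le_add e1 (add_le_add e2 e3)
    _ = 4 * M ^ 2 * S + (4 * M ^ 2 * K + K + 2 * A * K) * (t * G) := by ring
    _ ≤ (4 * M ^ 2 * (1 + K) + K + 2 * A * K) * S +
          (4 * M ^ 2 * (1 + K) + K + 2 * A * K) * (t * G) := by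
        gcongr
        · calc (4 * M ^ 2 : ℝ≥0∞) ≤ 4 * M ^ 2 * (1 + K) := le_mul_of_one_le_right' le_self_add
            _ ≤ _ := by
              rw [add_assoc]
              exact le_self_add
        · exact le_add_self
    _ = _ := by
        push_cast
        ring

theorem lintegral_indicator_Ici_rpow_le {q a : ℝ} (hq : q < 2) (ha : 0 ≤ a) :
    ENNReal.ofReal a ^ 2 * ∫⁻ s in Ioi (0 : ℝ), (if a ≤ s then ENNReal.ofReal (s ^ (q - 3)) else 0) ≤
      ENNReal.ofReal (1 / (2 - q)) * ENNReal.ofReal (a ^ q) := by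
  rcases ha.eq_or_lt with rfl | ha
  · simp
  have h1 : ∫⁻ s in Ioi (0 : ℝ), (if a ≤ s then ENNReal.ofReal (s ^ (q - 3)) else 0) ≤
      ∫⁻ s in Ioi a, ENNReal.ofReal (s ^ (q - 3)) := by
    have h2 (s : ℝ) : (if a ≤ s then ENNReal.ofReal (s ^ (q - 3)) else 0) =
        (Ici a).indicator (fun s => ENNReal.ofReal (s ^ (q - 3))) s := by
      simp [indicator_apply]
    simp_rw [h2]
    refine (setLIntegral_le_lintegral _ _).trans ?_
    rw [lintegral_indicator measurableSet_Ici, setLIntegral_congr Ioi_ae_eq_Ici]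
  have h3 : ∫⁻ s in Ioi a, ENNReal.ofReal (s ^ (q - 3)) = ENNReal.ofReal (a ^ (q - 2) / (2 - q)) := by
    rw [← ofReal_integral_eq_lintegral_ofReal (integrableOn_Ioi_rpow_of_lt (by linarith) ha)
      ((ae_restrict_iff' measurableSet_Ioi).2 (.of_forall fun s hs =>
        rpow_nonneg (ha.le.trans (le_of_lt hs)) _)), integral_Ioi_rpow_of_lt (by linarith) ha]
    congr 1
    rw [show q - 3 + 1 = -(2 - q) by ring, div_neg, neg_div, neg_neg, show -(2 - q) = q - 2 by ring]
  refine (mul_le_mul_right (h1.trans h3.le) _).trans_eq ?_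
  rw [← ENNReal.ofReal_pow ha.le, ← ENNReal.ofReal_mul (by positivity),
    ← ENNReal.ofReal_mul (by have : 0 < 2 - q := by linarith
                             positivity)]
  congr 1
  rw [rpow_sub ha, rpow_two]
  field_simp

theorem lintegral_indicator_Iio_rpow_le {q a : ℝ} (hq : 1 < q) (ha : 0 ≤ a) :
    ENNReal.ofReal a * ∫⁻ s in Ioi (0 : ℝ), (if s / 2 < a then ENNReal.ofReal (s ^ (q - 2)) else 0) ≤
      ENNReal.ofReal (2 ^ (q - 1) / (q - 1)) * ENNReal.ofReal (a ^ q) := by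
  rcases ha.eq_or_lt with rfl | ha
  · simp
  have h1 : ∫⁻ s in Ioi (0 : ℝ), (if s / 2 < a then ENNReal.ofReal (s ^ (q - 2)) else 0) ≤
      ∫⁻ s in Ioc 0 (2 * a), ENNReal.ofReal (s ^ (q - 2)) := by
    rw [← lintegral_indicator measurableSet_Ioi, ← lintegral_indicator measurableSet_Ioc]
    refine lintegral_mono fun s => ?_
    by_cases h0 : 0 < s
    · by_cases hs : s / 2 < a
      · have : s ∈ Ioc 0 (2 * a) := ⟨h0, by linarith⟩
        simp [h0, hs, indicator_of_mem this]
      · simp [h0, hs]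
    · simp [h0]
  have hi : IntervalIntegrable (fun s : ℝ => s ^ (q - 2)) volume 0 (2 * a) :=
    intervalIntegral.intervalIntegrable_rpow' (by linarith)
  have h3 : ∫⁻ s in Ioc 0 (2 * a), ENNReal.ofReal (s ^ (q - 2)) =
      ENNReal.ofReal ((2 * a) ^ (q - 1) / (q - 1)) := by
    rw [← ofReal_integral_eq_lintegral_ofReal
      ((intervalIntegrable_iff_integrableOn_Ioc_of_le (by linarith)).1 hi)
      ((ae_restrict_iff' measurableSet_Ioc).2 (.of_forall fun s hs =>
        rpow_nonneg hs.1.le _)), ← intervalIntegral.integral_of_le (by linarith),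
      integral_rpow (.inl (by linarith))]
    rw [show q - 2 + 1 = q - 1 by ring, zero_rpow (by linarith), sub_zero]
  refine (mul_le_mul_right (h1.trans h3.le) _).trans_eq ?_
  have hq1 : 0 < q - 1 := by linarith
  rw [← ENNReal.ofReal_mul (by positivity), ← ENNReal.ofReal_mul (by positivity)]
  congr 1
  rw [mul_rpow (by norm_num) ha.le, rpow_sub_one ha.ne']
  field_simp

theorem exists_lintegral_rpow_le_of_weakType {q : ℝ} (hq1 : 1 < q) (hq2 : q < 2) (C : ℝ≥0) :
    ∃ C' : ℝ≥0, ∀ f h : V → ℂ, Measurable f → Measurable h →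
      (∀ t : ℝ≥0∞, t ≠ 0 → t ≠ ⊤ → t ^ 2 * volume {x | t < ‖h x‖ₑ} ≤
        C * ((∫⁻ x in {x | ‖f x‖ₑ ≤ t}, ‖f x‖ₑ ^ 2) +
          t * ∫⁻ x in {x | t / 2 < ‖f x‖ₑ}, ‖f x‖ₑ)) →
      ∫⁻ x, ‖h x‖ₑ ^ q ≤ C' * ∫⁻ x, ‖f x‖ₑ ^ q := by
  set K : ℝ≥0 := (1 / (2 - q)).toNNReal + (2 ^ (q - 1) / (q - 1)).toNNReal with hK
  refine ⟨q.toNNReal * (C * K), fun f h hf hh hw => ?_⟩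
  have hq0 : 0 < q := by linarith
  have hconv (g : V → ℂ) (x : V) : ‖g x‖ₑ ^ q = ENNReal.ofReal (‖g x‖ ^ q) := by
    rw [← ofReal_norm, ENNReal.ofReal_rpow_of_nonneg (norm_nonneg _) hq0.le]
  simp_rw [hconv]
  rw [lintegral_rpow_eq_lintegral_meas_lt_mul volume (.of_forall fun x => norm_nonneg _)
    hh.norm.aemeasurable hq0]
  have hpt (s : ℝ) (hs : s ∈ Ioi (0 : ℝ)) : volume {x | s < ‖h x‖} * ENNReal.ofReal (s ^ (q - 1)) ≤
      C * ∫⁻ x, (ENNReal.ofReal ‖f x‖ ^ 2 * (if ‖f x‖ ≤ s then ENNReal.ofReal (s ^ (q - 3)) else 0) +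
        ENNReal.ofReal ‖f x‖ * (if s / 2 < ‖f x‖ then ENNReal.ofReal (s ^ (q - 2)) else 0)) := by
    have hs : 0 < s := hs
    have h1 := hw (ENNReal.ofReal s) (by simpa using hs) ENNReal.ofReal_ne_top
    have e1 : {x | ENNReal.ofReal s < ‖h x‖ₑ} = {x | s < ‖h x‖} := by
      ext x
      simp only [mem_ofPred_eq, ← ofReal_norm]
      exact ENNReal.ofReal_lt_ofReal_iff_of_nonneg hs.le
    have e2 : {x | ‖f x‖ₑ ≤ ENNReal.ofReal s} = {x | ‖f x‖ ≤ s} := by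
      ext x
      simp only [mem_ofPred_eq, ← ofReal_norm]
      exact ENNReal.ofReal_le_ofReal_iff hs.le
    have e3 : {x | ENNReal.ofReal s / 2 < ‖f x‖ₑ} = {x | s / 2 < ‖f x‖} := by
      ext x
      have : ENNReal.ofReal s / 2 = ENNReal.ofReal (s / 2) := by
        rw [ENNReal.ofReal_div_of_pos two_pos, ENNReal.ofReal_ofNat]
      simp only [mem_ofPred_eq, ← ofReal_norm, this]
      exact ENNReal.ofReal_lt_ofReal_iff_of_nonneg (by positivity)
    rw [e1, e2, e3, ← lintegral_indicator (measurableSet_le hf.norm measurable_const),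
      ← lintegral_indicator (measurableSet_lt measurable_const hf.norm)] at h1
    have m1 : MeasurableSet {x | ‖f x‖ ≤ s} := measurableSet_le hf.norm measurable_const
    have m2 : MeasurableSet {x | s / 2 < ‖f x‖} := measurableSet_lt measurable_const hf.norm
    have c1 : ENNReal.ofReal (s ^ (q - 1)) = ENNReal.ofReal (s ^ (q - 3)) * ENNReal.ofReal s ^ 2 := by
      rw [← ENNReal.ofReal_pow hs.le, ← ENNReal.ofReal_mul (by positivity), ← rpow_natCast,
        ← rpow_add hs]
      congr 2
      norm_num
      ring
    have c2 : ENNReal.ofReal (s ^ (q - 2)) = ENNReal.ofReal (s ^ (q - 3)) * ENNReal.ofReal s := by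
      rw [← ENNReal.ofReal_mul (by positivity), ← rpow_add_one hs.ne']
      congr 2
      ring
    calc volume {x | s < ‖h x‖} * ENNReal.ofReal (s ^ (q - 1))
        = ENNReal.ofReal (s ^ (q - 3)) * (ENNReal.ofReal s ^ 2 * volume {x | s < ‖h x‖}) := by
          rw [c1]
          ring
      _ ≤ _ := mul_le_mul_right h1 _
      _ = C * ((ENNReal.ofReal (s ^ (q - 3)) * ∫⁻ x, {x | ‖f x‖ ≤ s}.indicator (fun x => ‖f x‖ₑ ^ 2) x)
            + ENNReal.ofReal (s ^ (q - 2)) * ∫⁻ x, {x | s / 2 < ‖f x‖}.indicator (fun x => ‖f x‖ₑ) x) := by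
          rw [c2]
          ring
      _ = _ := by
          rw [← lintegral_const_mul _ ((hf.enorm.pow_const 2).indicator m1),
            ← lintegral_const_mul _ (hf.enorm.indicator m2),
            ← lintegral_add_left (((hf.enorm.pow_const 2).indicator m1).const_mul _)]
          congr 1
          refine lintegral_congr fun x => ?_
          simp only [indicator_apply, mem_ofPred_eq, ofReal_norm]
          split_ifs <;> ring
  have hmeas : Measurable (Function.uncurry fun (s : ℝ) (x : V) =>
      ENNReal.ofReal ‖f x‖ ^ 2 * (if ‖f x‖ ≤ s then ENNReal.ofReal (s ^ (q - 3)) else 0) +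
        ENNReal.ofReal ‖f x‖ * (if s / 2 < ‖f x‖ then ENNReal.ofReal (s ^ (q - 2)) else 0)) := by
    have mf : Measurable fun z : ℝ × V => ‖f z.2‖ := hf.norm.comp measurable_snd
    refine Measurable.add ?_ ?_
    · exact (mf.ennreal_ofReal.pow_const 2).mul (Measurable.ite (measurableSet_le mf measurable_fst)
        (measurable_fst.pow_const _).ennreal_ofReal measurable_const)
    · exact mf.ennreal_ofReal.mul (Measurable.ite
        (measurableSet_lt (measurable_fst.div_const 2) mf)
        (measurable_fst.pow_const _).ennreal_ofReal measurable_const)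
  have m1 (x : V) : Measurable fun s : ℝ =>
      if ‖f x‖ ≤ s then ENNReal.ofReal (s ^ (q - 3)) else 0 :=
    Measurable.ite measurableSet_Ici (measurable_id.pow_const _).ennreal_ofReal measurable_const
  have m2 (x : V) : Measurable fun s : ℝ =>
      if s / 2 < ‖f x‖ then ENNReal.ofReal (s ^ (q - 2)) else 0 :=
    Measurable.ite (measurableSet_lt (measurable_id.div_const 2) measurable_const)
      (measurable_id.pow_const _).ennreal_ofReal measurable_const
  calc ENNReal.ofReal q * ∫⁻ s in Ioi (0 : ℝ), volume {x | s < ‖h x‖} * ENNReal.ofReal (s ^ (q - 1))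
      ≤ ENNReal.ofReal q * (C * ∫⁻ s in Ioi (0 : ℝ), ∫⁻ x,
        (ENNReal.ofReal ‖f x‖ ^ 2 * (if ‖f x‖ ≤ s then ENNReal.ofReal (s ^ (q - 3)) else 0) +
          ENNReal.ofReal ‖f x‖ * (if s / 2 < ‖f x‖ then ENNReal.ofReal (s ^ (q - 2)) else 0))) := by
        gcongr
        rw [← lintegral_const_mul' _ _ ENNReal.coe_ne_top]
        exact setLIntegral_mono' measurableSet_Ioi hpt
    _ = ENNReal.ofReal q * (C * ∫⁻ x, ∫⁻ s in Ioi (0 : ℝ),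
        (ENNReal.ofReal ‖f x‖ ^ 2 * (if ‖f x‖ ≤ s then ENNReal.ofReal (s ^ (q - 3)) else 0) +
          ENNReal.ofReal ‖f x‖ * (if s / 2 < ‖f x‖ then ENNReal.ofReal (s ^ (q - 2)) else 0))) := by
        rw [lintegral_lintegral_swap hmeas.aemeasurable]
    _ ≤ ENNReal.ofReal q * (C * ∫⁻ x, K * ENNReal.ofReal (‖f x‖ ^ q)) := by
        gcongr with x
        rw [lintegral_add_left ((m1 x).const_mul _), lintegral_const_mul _ (m1 x),
          lintegral_const_mul _ (m2 x), hK, ENNReal.coe_add, add_mul]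
        exact add_le_add (lintegral_indicator_Ici_rpow_le hq2 (norm_nonneg _))
          (lintegral_indicator_Iio_rpow_le hq1 (norm_nonneg _))
    _ = _ := by
        rw [lintegral_const_mul _ (hf.norm.pow_const q).ennreal_ofReal]
        push_cast
        rw [mul_assoc, mul_assoc]
        rfl

/-! ### `L^p` bounds -/

/-- The Mikhlin condition of order `N` with constant `M`. -/
structure MikhlinBound (N : ℕ) (M : ℝ) (m : V → ℂ) : Prop where
  norm_le : ∀ ξ, ‖m ξ‖ ≤ M
  contDiffOn : ContDiffOn ℝ N m {0}ᶜ
  pow_mul_norm_le : ∀ i ≤ N, ∀ ξ, ξ ≠ 0 → ‖ξ‖ ^ i * ‖iteratedFDerivWithin ℝ i m {0}ᶜ ξ‖ ≤ M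

theorem MikhlinBound.conj {N : ℕ} {M : ℝ} {m : V → ℂ} (h : MikhlinBound N M m) :
    MikhlinBound N M fun ξ => starRingEnd ℂ (m ξ) where
  norm_le ξ := by simpa using h.norm_le ξ
  contDiffOn := Complex.conjCLE.contDiff.comp_contDiffOn h.contDiffOn
  pow_mul_norm_le i hi ξ hξ := by
    have h1 := Complex.conjLIE.norm_iteratedFDerivWithin_comp_left m
      (isOpen_compl_singleton (x := (0 : V))).uniqueDiffOn (x := ξ) (by simpa using hξ) i
    have h2 : (Complex.conjLIE ∘ m) = fun ξ => starRingEnd ℂ (m ξ) := by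
      ext ξ; simp
    rw [h2] at h1
    rw [h1]
    exact h.pow_mul_norm_le i hi ξ hξ

theorem exists_lintegral_rpow_multiplier_le [Nontrivial V] {N : ℕ}
    (hN : Module.finrank ℝ V + 1 ≤ 2 * N) {q : ℝ} (hq1 : 1 < q) (hq2 : q < 2) {M : ℝ}
    (hM : 0 ≤ M) :
    ∃ C : ℝ≥0, ∀ (m : V → ℂ) (T : Lp (α := V) ℂ 2 volume →L[ℂ] Lp (α := V) ℂ 2 volume),
      MikhlinBound N M m → IsL2Multiplier m T → ∀ u : Lp (α := V) ℂ 2 volume,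
      ∫⁻ x, ‖T u x‖ₑ ^ q ≤ C * ∫⁻ x, ‖u x‖ₑ ^ q := by
  obtain ⟨C₁, hC₁⟩ := exists_multiplier_atom_bound (V := V) hN
  obtain ⟨C₂, hC₂⟩ := exists_weakType_bound (V := V) M.toNNReal (C₁ * M.toNNReal)
  obtain ⟨C₃, hC₃⟩ := exists_lintegral_rpow_le_of_weakType (V := V) hq1 hq2 C₂
  refine ⟨C₃, fun m T hm hT u => hC₃ u (T u) (Lp.stronglyMeasurable _).measurable
    (Lp.stronglyMeasurable _).measurable fun t ht0 ht => hC₂ T (fun v => ?_)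
    (fun b c r hr hb hbs hb0 => ?_) u t ht0 ht⟩
  · rw [Real.coe_toNNReal _ hM]
    exact hT.norm_apply_le hm.norm_le v
  · rw [ENNReal.coe_mul]
    exact hC₁ M m T hM hm.norm_le hm.contDiffOn hm.pow_mul_norm_le hT b c r hr hb hbs hb0

theorem lintegral_rpow_le_of_adjoint {p q : ℝ} (hpq : p.HolderConjugate q) (hp : 2 ≤ p)
    {C : ℝ≥0} {B : ℝ} {h u : Lp (α := V) ℂ 2 volume}
    (hadj : ∀ g : Lp (α := V) ℂ 2 volume, ∃ v : Lp (α := V) ℂ 2 volume,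
      inner ℂ h g = inner ℂ u v ∧ ∫⁻ x, ‖v x‖ₑ ^ q ≤ C * ∫⁻ x, ‖g x‖ₑ ^ q)
    (hB : ∀ᵐ x, ‖h x‖ ≤ B) :
    (∫⁻ x, ‖h x‖ₑ ^ p) ^ (1 / p) ≤ (C : ℝ≥0∞) ^ (1 / q) * (∫⁻ x, ‖u x‖ₑ ^ p) ^ (1 / p) := by
  have hp0 : 0 < p := hpq.pos
  have hq0 : 0 < q := hpq.symm.pos
  set g : V → ℂ := fun x => ((‖h x‖ ^ (p - 2) : ℝ) : ℂ) * h x with hg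
  have hgm : AEStronglyMeasurable g := by
    have h1 := (Lp.stronglyMeasurable h).measurable
    exact (Complex.measurable_ofReal.comp (h1.norm.pow_const _) |>.mul h1).aestronglyMeasurable
  have hg2 : MemLp g 2 := by
    refine (Lp.memLp h).of_le_mul (c := B ^ (p - 2)) hgm ?_
    filter_upwards [hB] with x hx
    rw [hg, norm_mul, Complex.norm_real, Real.norm_of_nonneg (by positivity)]
    gcongr
  obtain ⟨v, hv, hvC⟩ := hadj (hg2.toLp g)
  have hgn (x : V) : ‖g x‖ₑ = ‖h x‖ₑ ^ (p - 1) := by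
    by_cases hx : h x = 0
    · simp [hg, hx, ENNReal.zero_rpow_of_pos (show 0 < p - 1 by linarith)]
    have hx' : 0 < ‖h x‖ := norm_pos_iff.2 hx
    rw [← ofReal_norm, ← ofReal_norm, ENNReal.ofReal_rpow_of_pos hx']
    congr 1
    rw [hg, norm_mul, Complex.norm_real, Real.norm_of_nonneg (by positivity)]
    nth_rw 2 [← rpow_one ‖h x‖]
    rw [← rpow_add hx']
    ring_nf
  have hgq : ∫⁻ x, ‖hg2.toLp g x‖ₑ ^ q = ∫⁻ x, ‖h x‖ₑ ^ p := by
    refine lintegral_congr_ae ?_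
    filter_upwards [hg2.coeFn_toLp] with x hx
    rw [hx, hgn, ← ENNReal.rpow_mul, hpq.sub_one_mul_conj]
  set X := ∫⁻ x, ‖h x‖ₑ ^ p with hX
  have hXtop : X ≠ ⊤ := by
    have h1 : X ≤ ENNReal.ofReal (B ^ (p - 2)) * ∫⁻ x, ‖h x‖ₑ ^ 2 := by
      rw [← lintegral_const_mul' _ _ ENNReal.ofReal_ne_top]
      refine lintegral_mono_ae ?_
      filter_upwards [hB] with x hx
      have hB0 : 0 ≤ B := (norm_nonneg _).trans hx
      have h2 : ‖h x‖ₑ ^ p = ‖h x‖ₑ ^ (p - 2) * ‖h x‖ₑ ^ 2 := by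
        rw [← ENNReal.rpow_ofNat, ← ENNReal.rpow_add_of_nonneg _ _ (by linarith) (by norm_num),
          sub_add_cancel]
      rw [h2]
      refine mul_le_mul_left ?_ _
      rw [← ENNReal.ofReal_rpow_of_nonneg hB0 (by linarith)]
      refine ENNReal.rpow_le_rpow ?_ (by linarith)
      rw [← ofReal_norm]
      exact ENNReal.ofReal_le_ofReal hx
    refine ne_top_of_le_ne_top (ENNReal.mul_ne_top ENNReal.ofReal_ne_top ?_) h1
    rw [lintegral_enorm_sq_eq]
    exact ENNReal.pow_ne_top (Lp.memLp h).2.ne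
  have hinner : X = ‖inner ℂ h (hg2.toLp g)‖ₑ := by
    have h1 : inner ℂ h (hg2.toLp g) = ∫ x, ((‖h x‖ ^ p : ℝ) : ℂ) := by
      rw [L2.inner_def]
      refine integral_congr_ae ?_
      filter_upwards [hg2.coeFn_toLp] with x hx
      rw [hx]
      by_cases hx0 : h x = 0
      · simp [hx0, hg, zero_rpow hp0.ne']
      have hx' : 0 < ‖h x‖ := norm_pos_iff.2 hx0
      rw [hg]
      simp only [RCLike.inner_apply]
      rw [mul_assoc, Complex.mul_conj, Complex.normSq_eq_norm_sq, ← Complex.ofReal_mul,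
        ← rpow_two, ← rpow_add hx', sub_add_cancel]
    rw [h1, integral_complex_ofReal, ← ofReal_norm]
    have h2 : 0 ≤ ∫ x, ‖h x‖ ^ p := integral_nonneg fun x => by positivity
    have h3 (x : V) : ENNReal.ofReal (‖h x‖ ^ p) = ‖h x‖ₑ ^ p := by
      rw [← ofReal_norm, ENNReal.ofReal_rpow_of_nonneg (norm_nonneg _) hp0.le]
    rw [Complex.norm_real, Real.norm_of_nonneg h2, ofReal_integral_eq_lintegral_ofReal ?_
      (.of_forall fun x => by positivity)]
    · simp_rw [h3]; rfl
    · refine ⟨((Lp.stronglyMeasurable h).measurable.norm.pow_const _).aestronglyMeasurable, ?_⟩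
      rw [hasFiniteIntegral_iff_ofReal (.of_forall fun x => by positivity)]
      simp_rw [h3]
      exact hXtop.lt_top
  have hmain : X ≤ (∫⁻ x, ‖u x‖ₑ ^ p) ^ (1 / p) * ((C : ℝ≥0∞) * X) ^ (1 / q) := by
    calc X = ‖∫ x, inner ℂ (u x) (v x)‖ₑ := by rw [hinner, hv, L2.inner_def]
      _ ≤ ∫⁻ x, ‖inner ℂ (u x) (v x)‖ₑ := enorm_integral_le_lintegral_enorm _
      _ = ∫⁻ x, ((fun x => ‖u x‖ₑ) * fun x => ‖v x‖ₑ) x := by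
        refine lintegral_congr fun x => ?_
        simp [RCLike.inner_apply, enorm_mul, mul_comm]
      _ ≤ (∫⁻ x, ‖u x‖ₑ ^ p) ^ (1 / p) * (∫⁻ x, ‖v x‖ₑ ^ q) ^ (1 / q) :=
        ENNReal.lintegral_mul_le_Lp_mul_Lq _ hpq (Lp.aestronglyMeasurable u).enorm
          (Lp.aestronglyMeasurable v).enorm
      _ ≤ _ := by
        rw [← hgq]
        gcongr
  rcases eq_or_ne X 0 with h0 | h0
  · rw [h0, ENNReal.zero_rpow_of_pos (by positivity)]
    exact zero_le
  have h4 : X ^ (1 / q) ≠ 0 := by simp [h0, hXtop]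
  have h5 : X ^ (1 / q) ≠ ⊤ := ENNReal.rpow_ne_top_of_nonneg (by positivity) hXtop
  refine (ENNReal.mul_le_mul_iff_left h4 h5).1 ?_
  rw [← ENNReal.rpow_add _ _ h0 hXtop, one_div, one_div, hpq.inv_add_inv_eq_one, ENNReal.rpow_one]
  refine hmain.trans_eq ?_
  rw [ENNReal.mul_rpow_of_nonneg _ _ (by positivity), one_div, one_div]
  ring

theorem exists_lintegral_rpow_le_of_ae_bounded [Nontrivial V] {N : ℕ}
    (hN : Module.finrank ℝ V + 1 ≤ 2 * N) {p : ℝ} (hp : 1 < p) {M : ℝ} (hM : 0 ≤ M) :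
    ∃ C : ℝ≥0, ∀ (m : V → ℂ) (T : Lp (α := V) ℂ 2 volume →L[ℂ] Lp (α := V) ℂ 2 volume),
      MikhlinBound N M m → IsL2Multiplier m T → ∀ (u : Lp (α := V) ℂ 2 volume) (B : ℝ),
      (∀ᵐ x, ‖T u x‖ ≤ B) →
      (∫⁻ x, ‖T u x‖ₑ ^ p) ^ (1 / p) ≤ C * (∫⁻ x, ‖u x‖ₑ ^ p) ^ (1 / p) := by
  have hp0 : 0 < 1 / p := by positivity
  have root {C : ℝ≥0} {a b : ℝ≥0∞} (h : a ≤ C * b) :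
      a ^ (1 / p) ≤ (C ^ (1 / p) : ℝ≥0) * b ^ (1 / p) := by
    rw [ENNReal.coe_rpow_of_nonneg _ hp0.le, ← ENNReal.mul_rpow_of_nonneg _ _ hp0.le]
    exact ENNReal.rpow_le_rpow h hp0.le
  rcases lt_trichotomy p 2 with hp2 | rfl | hp2
  · obtain ⟨C, hC⟩ := exists_lintegral_rpow_multiplier_le (V := V) hN hp hp2 hM
    exact ⟨C ^ (1 / p), fun m T hm hT u _ _ => root (hC m T hm hT u)⟩
  · refine ⟨(M.toNNReal ^ 2) ^ (1 / (2 : ℝ)), fun m T hm hT u _ _ => root ?_⟩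
    simp_rw [ENNReal.rpow_ofNat, ENNReal.coe_pow]
    refine lintegral_enorm_sq_apply_le (fun v => ?_) u
    rw [Real.coe_toNNReal _ hM]
    exact hT.norm_apply_le hm.norm_le v
  · have hpq := Real.HolderConjugate.conjExponent hp
    have hq2 : p.conjExponent < 2 := by
      rw [Real.conjExponent, div_lt_iff₀ (by linarith)]
      linarith
    obtain ⟨C, hC⟩ := exists_lintegral_rpow_multiplier_le (V := V) hN hpq.symm.lt hq2 hM
    refine ⟨C ^ (1 / p.conjExponent), fun m T hm hT u B hB => ?_⟩
    obtain ⟨S, hS⟩ := exists_isL2Multiplier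
      (aestronglyMeasurable_of_continuousOn_compl_zero hm.conj.contDiffOn.continuousOn)
      hm.conj.norm_le
    rw [ENNReal.coe_rpow_of_nonneg _ (one_div_nonneg.2 hpq.symm.nonneg)]
    exact lintegral_rpow_le_of_adjoint hpq hp2.le
      (fun g => ⟨S g, hT.inner_apply hS u g, hC _ S hm.conj hS g⟩) hB

theorem exists_eLpNorm_multiplier_le [Nontrivial V] {N : ℕ}
    (hN : Module.finrank ℝ V + 1 ≤ 2 * N) {p : ℝ} (hp : 1 < p) {M : ℝ} (hM : 0 ≤ M) :
    ∃ C : ℝ≥0, ∀ m : V → ℂ, MikhlinBound N M m → ∀ f : SchwartzMap V ℂ,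
      eLpNorm (𝓕⁻ fun ξ => m ξ * 𝓕 (⇑f) ξ) (ENNReal.ofReal p) volume ≤
        C * eLpNorm (⇑f) (ENNReal.ofReal p) volume := by
  obtain ⟨C, hC⟩ := exists_lintegral_rpow_le_of_ae_bounded (V := V) hN hp hM
  refine ⟨C, fun m hm f => ?_⟩
  have hmm := aestronglyMeasurable_of_continuousOn_compl_zero hm.contDiffOn.continuousOn
  obtain ⟨T, hT⟩ := exists_isL2Multiplier hmm hm.norm_le
  have hf2 : MemLp (⇑f) 2 := f.memLp 2
  have hi : Integrable fun ξ => m ξ * 𝓕 (⇑f) ξ := by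
    rw [← SchwartzMap.fourier_coe]
    exact (𝓕 f).integrable.bdd_mul hmm (.of_forall hm.norm_le)
  have hTf := hT.coeFn_apply_toLp hmm hm.norm_le f.integrable hf2 hi
  have h := hC m T hm hT (hf2.toLp f) (∫ ξ, ‖m ξ * 𝓕 (⇑f) ξ‖) (by
    filter_upwards [hTf] with x hx
    rw [hx]
    exact VectorFourier.norm_fourierIntegral_le_integral_norm _ _ _ _ _)
  have hp0 : ENNReal.ofReal p ≠ 0 := by simp; linarith
  rw [eLpNorm_congr_ae hTf.symm, eLpNorm_congr_ae hf2.coeFn_toLp.symm,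
    eLpNorm_eq_lintegral_rpow_enorm_toReal hp0 ENNReal.ofReal_ne_top,
    eLpNorm_eq_lintegral_rpow_enorm_toReal hp0 ENNReal.ofReal_ne_top,
    ENNReal.toReal_ofReal (by linarith)]
  exact h

end HormanderMikhlin

/-- The Hörmander–Mikhlin multiplier theorem on `ℝ^d`: if `m` is bounded, of class
`C^{⌊d/2⌋+1}` away from the origin, and `|ξ|^{|α|} |∂^α m(ξ)| ≤ C_m` for all
`0 ≤ |α| ≤ ⌊d/2⌋+1` and `ξ ≠ 0`, then `T_m f = 𝓕⁻¹(m·𝓕f)` is bounded on `L^p(ℝ^d)`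
for all `1 < p < ∞`, with constant depending only on `d`, `p`, `C_m`. -/
theorem hormander_mikhlin_multiplier
    (d : ℕ) (hd : 1 ≤ d) (p : ℝ) (hp1 : 1 < p) (Cm : ℝ) (hCm : 0 < Cm) :
    ∃ C : ℝ, 0 < C ∧
      ∀ m : EuclideanSpace ℝ (Fin d) → ℂ,
        (∀ ξ : EuclideanSpace ℝ (Fin d), ‖m ξ‖ ≤ Cm) →
        ContDiffOn ℝ (d / 2 + 1 : ℕ) m {(0 : EuclideanSpace ℝ (Fin d))}ᶜ →
        (∀ i : ℕ, i ≤ d / 2 + 1 → ∀ ξ : EuclideanSpace ℝ (Fin d), ξ ≠ 0 →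
          ‖ξ‖ ^ i *
              ‖iteratedFDerivWithin ℝ i m {(0 : EuclideanSpace ℝ (Fin d))}ᶜ ξ‖ ≤ Cm) →
        ∀ f : SchwartzMap (EuclideanSpace ℝ (Fin d)) ℂ,
          eLpNorm (𝓕⁻ fun ξ => m ξ * 𝓕 (⇑f) ξ) (ENNReal.ofReal p) volume ≤
            ENNReal.ofReal C * eLpNorm (⇑f) (ENNReal.ofReal p) volume := by
  have : Nonempty (Fin d) := ⟨⟨0, hd⟩⟩
  obtain ⟨C, hC⟩ := exists_eLpNorm_multiplier_le (V := EuclideanSpace ℝ (Fin d)) (N := d / 2 + 1)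
    (by rw [finrank_euclideanSpace_fin]; omega) hp1 hCm.le
  refine ⟨C + 1, by positivity, fun m hm hmd hmM f => (hC m ⟨hm, hmd, hmM⟩ f).trans ?_⟩
  gcongr
  rw [← ENNReal.ofReal_coe_nnreal]
  exact ENNReal.ofReal_le_ofReal (by linarith)
end

section
/- (Iwasawa decomposition of SL_n(ℝ).) Let n ≥ 1. Every real n×n matrix M with det M = 1 can be written uniquely as M = K·D·N, where K is an orthogonal matrix with det K = 1 (K ∈ SO(n)), D is a diagonal matrix with strictly positive diagonal entries and det D = 1, and N is an upper triangular matrix with all diagonal entries equal to 1. -/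
open Matrix

namespace Matrix

section Triangular

variable {m : Type*} [Fintype m] [LinearOrder m] {R : Type*} [CommRing R]

/-- The diagonal of a product of upper triangular matrices is the product of the diagonals. -/
theorem IsUpperTriangular.mul_apply_self {A B : Matrix m m R}
    (hA : A.IsUpperTriangular) (hB : B.IsUpperTriangular) (i : m) :
    (A * B) i i = A i i * B i i := by
  rw [mul_apply]
  refine Finset.sum_eq_single i (fun j _ hj => ?_) (by simp)
  rcases lt_or_gt_of_ne hj with h | h
  · rw [hA h, zero_mul]
  · rw [hB h, mul_zero]

/-- An orthogonal upper triangular matrix with positive diagonal is the identity. -/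
theorem IsUpperTriangular.eq_one_of_transpose_mul_self [LinearOrder R] [IsStrictOrderedRing R]
    {Q : Matrix m m R} (hQ : Q.IsUpperTriangular) (hpos : ∀ i, 0 < Q i i) (h : Qᵀ * Q = 1) :
    Q = 1 := by
  have hinv : Q⁻¹ = Qᵀ := inv_eq_left_inv h
  let _ := invertibleOfLeftInverse _ _ h
  have hQt : Qᵀ.IsUpperTriangular := hinv ▸ blockTriangular_inv_of_blockTriangular hQ
  ext i j
  rcases lt_trichotomy i j with hij | rfl | hij
  · rw [one_apply_ne hij.ne]
    exact hQt hij
  · have hii : Q i i * Q i i = 1 := by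
      have := hQt.mul_apply_self hQ i
      rwa [h, one_apply_eq, transpose_apply, eq_comm] at this
    rw [one_apply_eq]
    nlinarith [hpos i]
  · rw [one_apply_ne hij.ne']
    exact hQ hij

end Triangular

/-- Uniqueness of the QR factorisation with positive diagonal. -/
theorem eq_and_eq_of_orthogonal_mul_isUpperTriangular {m R : Type*} [Fintype m] [LinearOrder m]
    [Field R] [LinearOrder R] [IsStrictOrderedRing R] {K K' T T' : Matrix m m R}
    (hK : Kᵀ * K = 1) (hK' : K'ᵀ * K' = 1)
    (hT : T.IsUpperTriangular) (hT' : T'.IsUpperTriangular)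
    (hpos : ∀ i, 0 < T i i) (hpos' : ∀ i, 0 < T' i i) (h : K * T = K' * T') :
    K = K' ∧ T = T' := by
  have hdet : IsUnit T.det := by
    rw [det_of_isUpperTriangular hT]
    exact (Finset.prod_pos fun i _ => hpos i).ne'.isUnit
  let _ := invertibleOfIsUnitDet T hdet
  have hQT : K'ᵀ * K * T = T' := by
    rw [Matrix.mul_assoc, h, ← Matrix.mul_assoc, hK', Matrix.one_mul]
  have hQ : (K'ᵀ * K).IsUpperTriangular := by
    have : K'ᵀ * K = T' * T⁻¹ := by
      rw [← hQT, Matrix.mul_assoc, mul_nonsing_inv _ hdet, Matrix.mul_one]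
    rw [this]
    exact hT'.mul (blockTriangular_inv_of_blockTriangular hT)
  have hQpos : ∀ i, 0 < (K'ᵀ * K) i i := fun i => by
    have := hQ.mul_apply_self hT i
    rw [hQT] at this
    exact (pos_iff_pos_of_mul_pos (this ▸ hpos' i)).mpr (hpos i)
  have hQ1 : K'ᵀ * K = 1 := by
    refine hQ.eq_one_of_transpose_mul_self hQpos ?_
    rw [transpose_mul, transpose_transpose, Matrix.mul_assoc, ← Matrix.mul_assoc K',
      mul_eq_one_comm.mp hK', Matrix.one_mul, hK]
  refine ⟨?_, by rw [← hQT, hQ1, Matrix.one_mul]⟩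
  rw [← Matrix.one_mul K, ← mul_eq_one_comm.mp hK', Matrix.mul_assoc, hQ1, Matrix.mul_one]

/-- Gram–Schmidt in matrix form: an invertible real matrix is the product of an orthogonal matrix,
a positive diagonal matrix and an upper unitriangular matrix. -/
theorem exists_orthogonal_mul_diagonal_mul_unitriangular {m : Type*} [Fintype m] [LinearOrder m]
    [LocallyFiniteOrderBot m] (M : Matrix m m ℝ) (hM : IsUnit M) :
    ∃ (K : Matrix m m ℝ) (d : m → ℝ) (N : Matrix m m ℝ), Kᵀ * K = 1 ∧ (∀ i, 0 < d i) ∧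
      N.IsUpperTriangular ∧ (∀ i, N i i = 1) ∧ M = K * diagonal d * N := by
  let f : m → EuclideanSpace ℝ m := fun j => WithLp.toLp 2 (M.col j)
  have hf : LinearIndependent ℝ f :=
    (linearIndependent_cols_of_isUnit hM).map' (WithLp.linearEquiv 2 ℝ (m → ℝ)).symm.toLinearMap
      (LinearEquiv.ker _)
  let g := InnerProductSpace.gramSchmidt ℝ f
  let e := InnerProductSpace.gramSchmidtNormed ℝ f
  have hg : ∀ i, 0 < ‖g i‖ := fun i => norm_pos_iff.mpr (InnerProductSpace.gramSchmidt_ne_zero i hf)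
  have he : Orthonormal ℝ e := InnerProductSpace.gramSchmidtNormed_orthonormal hf
  have hge : ∀ i k, e i k * ‖g i‖ = g i k := fun i k => by
    have : e i k = ‖g i‖⁻¹ * g i k := rfl
    rw [this]
    field_simp [(hg i).ne']
  refine ⟨of fun i j => e j i, fun i => ‖g i‖,
    of fun i j => if i < j then inner ℝ (g i) (f j) / ‖g i‖ ^ 2 else if i = j then 1 else 0,
    ?_, hg, ?_, by simp, ?_⟩
  · ext i j
    rw [one_apply, ← orthonormal_iff_ite.mp he i j]
    simp [mul_apply, PiLp.inner_apply, mul_comm]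
  · intro i j hij
    have hij : j < i := hij
    simp [hij.not_gt, hij.ne']
  · ext k j
    have h : M k j = g j k + ∑ i ∈ Finset.Iio j, inner ℝ (g i) (f j) / ‖g i‖ ^ 2 * g i k := by
      simpa [f, g] using congrArg (fun v : EuclideanSpace ℝ m => v k)
        (InnerProductSpace.gramSchmidt_def'' ℝ f j)
    have hterm : ∀ i, g i k * (if i < j then inner ℝ (g i) (f j) / ‖g i‖ ^ 2 else
        if i = j then 1 else 0) = (if i = j then g i k else 0) +
          if i < j then inner ℝ (g i) (f j) / ‖g i‖ ^ 2 * g i k else 0 := fun i => by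
      rcases lt_trichotomy i j with hij | rfl | hij
      · simp [hij, hij.ne, mul_comm]
      · simp
      · simp [hij.not_gt, hij.ne']
    have hIio : Finset.univ.filter (· < j) = Finset.Iio j := by ext; simp
    rw [mul_apply]
    simp only [mul_diagonal, of_apply, hge, hterm]
    rw [Finset.sum_add_distrib, ← Finset.sum_filter _ (fun i => _ * _), hIio, h]
    simp

end Matrix

/-- Iwasawa decomposition of `SL_n(ℝ)`: every real `n×n` matrix `M` of determinant `1`
factors uniquely as `M = K·D·N` with `K ∈ SO(n)`, `D` diagonal with positive diagonal
entries and determinant `1`, and `N` unipotent upper triangular. -/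
theorem iwasawa_decomposition_SL (n : ℕ) (hn : 1 ≤ n)
    (M : Matrix (Fin n) (Fin n) ℝ) (hM : M.det = 1) :
    ∃! T : Matrix (Fin n) (Fin n) ℝ × Matrix (Fin n) (Fin n) ℝ × Matrix (Fin n) (Fin n) ℝ,
      (T.1ᵀ * T.1 = 1 ∧ T.1.det = 1) ∧
      (T.2.1.IsDiag ∧ (∀ i : Fin n, 0 < T.2.1 i i) ∧ T.2.1.det = 1) ∧
      ((∀ i j : Fin n, j < i → T.2.2 i j = 0) ∧ (∀ i : Fin n, T.2.2 i i = 1)) ∧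
      M = T.1 * T.2.1 * T.2.2 := by
  obtain ⟨K, d, N, hK, hd, hN, hN1, rfl⟩ := M.exists_orthogonal_mul_diagonal_mul_unitriangular
    ((isUnit_iff_isUnit_det M).mpr (hM ▸ isUnit_one))
  have hdpos : 0 < (diagonal d).det := by
    rw [det_diagonal]
    exact Finset.prod_pos fun i _ => hd i
  have hdet : K.det * (diagonal d).det = 1 := by
    rwa [det_mul, det_mul, det_of_isUpperTriangular hN, Finset.prod_eq_one fun i _ => hN1 i,
      mul_one] at hM
  have hKdet : K.det = 1 := by
    have h1 : K.det * K.det = 1 := by simpa using congrArg det hK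
    have h2 : 0 < K.det := (pos_iff_pos_of_mul_pos (hdet ▸ one_pos)).mpr hdpos
    nlinarith
  refine ⟨(K, diagonal d, N), ⟨⟨hK, hKdet⟩, ⟨isDiag_diagonal d, by simpa using hd,
    by simpa [hKdet] using hdet⟩, ⟨fun i j hij => hN hij, hN1⟩, rfl⟩, ?_⟩
  rintro ⟨K', D', N'⟩ ⟨⟨hK', -⟩, ⟨hD', hD'pos, -⟩, ⟨hN', hN'1⟩, h⟩
  dsimp only at hK' hD' hD'pos hN' hN'1 h
  obtain ⟨d', rfl⟩ : ∃ d', D' = diagonal d' := ⟨_, hD'.diagonal_diag.symm⟩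
  simp only [diagonal_apply_eq] at hD'pos
  replace hN' : N'.IsUpperTriangular := fun i j hij => hN' i j hij
  obtain ⟨rfl, hT⟩ := eq_and_eq_of_orthogonal_mul_isUpperTriangular hK' hK
    ((blockTriangular_diagonal d').mul hN') ((blockTriangular_diagonal d).mul hN)
    (by simpa [hN'1] using hD'pos) (by simpa [hN1] using hd) (by simp only [← Matrix.mul_assoc, h])
  have hT' : ∀ i j, d' i * N' i j = d i * N i j := fun i j => by
    simpa using congrFun (congrFun hT i) j
  obtain rfl : d' = d := funext fun i => by simpa [hN1, hN'1] using hT' i i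
  obtain rfl : N' = N := by
    ext i j
    exact mul_left_cancel₀ (hd i).ne' (hT' i j)
  rfl
end
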